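/- arXiv:math/0611668 — 2 statements merged into one kernel-verified Lean document; each statement's English description precedes it below -/
import Mathlib

section
/- Let G₁ and G₂ be nontrivial finitely generated groups with finite generating sets S₁ and S₂, and consider Bernoulli bond percolation on the Cayley graph of the free product G₁*G₂ with respect to the generating set S₁ ⊔ S₂. Then there is a unique p₀ ∈ (0,1] satisfying (χ₁(p₀) − 1)·(χ₂(p₀) − 1) = 1 (an equation in [0,∞], where χᵢ(p) ∈ [0,∞] is the expected cluster size of the identity in the Cayley graph of (Gᵢ,Sᵢ)), and this p₀ equals the critical probability p_c of the Cayley graph of G₁*G₂. -/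
open MeasureTheory ENNReal

namespace Perc

/-- Percolation configurations on the edge set `E`: each edge is `true` (open) or
`false` (closed). -/
abbrev Config (E : Type*) := E → Bool

/-- `μ` is the Bernoulli product measure `P_p` with parameter `p` on `{0,1}^E`: the measure
of every finite cylinder event is the corresponding product.  (This determines `μ` uniquely
on the product σ-algebra, since cylinders form a π-system generating it.) -/
def IsBernoulli {E : Type*} (p : ℝ) (μ : Measure (Config E)) : Prop :=
  ∀ (F : Finset E) (σ : E → Bool),
    μ {ω | ∀ e ∈ F, ω e = σ e} =
      ∏ e ∈ F, ENNReal.ofReal (if σ e then p else 1 - p)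

variable {G ι : Type*} [Group G]

/-- In the Cayley graph of `G` with edge set `G × ι`, where the edge `(a, i)` joins `a` and
`a * f i` (the function `f : ι → G` lists the generators, with multiplicity), this says that
vertices `a` and `b` are joined by some open edge of the configuration `ω`. -/
def Step (f : ι → G) (ω : Config (G × ι)) (a b : G) : Prop :=
  ∃ i : ι, (ω (a, i) = true ∧ b = a * f i) ∨ (ω (b, i) = true ∧ a = b * f i)

/-- `x` and `y` are connected by a path of open edges (`x ↔ y`). -/
def Conn (f : ι → G) (ω : Config (G × ι)) (x y : G) : Prop :=
  Relation.ReflTransGen (Step f ω) x y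

/-- The open cluster `C` of the identity. -/
def cluster (f : ι → G) (ω : Config (G × ι)) : Set G :=
  {x | Conn f ω 1 x}

/-- The percolation function `θ`: the probability that the cluster of the identity is
infinite. -/
noncomputable def theta (f : ι → G) (μ : Measure (Config (G × ι))) : ℝ :=
  (μ {ω | (cluster f ω).Infinite}).toReal

/-- The expected cluster size `χ = E(|C|) ∈ [0,∞]` (where `|C| ∈ ℕ∞` is coerced
to `ℝ≥0∞`). -/
noncomputable def chi (f : ι → G) (μ : Measure (Config (G × ι))) : ℝ≥0∞ :=
  ∫⁻ ω, ((cluster f ω).encard : ℝ≥0∞) ∂μ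

/-- The critical probability `p_c = inf {p ∈ [0,1] | θ(p) > 0}`, with the convention
`p_c = 1` if `θ` vanishes on `[0,1]`; here `μ p` is the percolation measure at
parameter `p`. -/
noncomputable def pc (f : ι → G) (μ : ℝ → Measure (Config (G × ι))) : ℝ :=
  sInf ({p | p ∈ Set.Icc (0 : ℝ) 1 ∧ 0 < theta f (μ p)} ∪ {1})

/-- The word metric on `G` with respect to the generators `f i`: the length of a shortest
word in the generators and their inverses taking `x` to `y`.  (When the generators generate
`G`, this is the graph distance in the Cayley graph.) -/
noncomputable def wdist (f : ι → G) (x y : G) : ℕ :=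
  sInf {n : ℕ | ∃ l : List G, l.length = n ∧
    (∀ g ∈ l, (∃ i, f i = g) ∨ (∃ i, (f i)⁻¹ = g)) ∧ x * l.prod = y}

/-- Schonmann's critical point
`p_exp = sup {p ∈ [0,1] | ∃ c > 0, γ > 0, ∀ x y, P_p(x ↔ y) ≤ c·exp(-γ·dist(x,y))}`. -/
noncomputable def pexp (f : ι → G) (μ : ℝ → Measure (Config (G × ι))) : ℝ :=
  sSup {p | p ∈ Set.Icc (0 : ℝ) 1 ∧ ∃ c > 0, ∃ γ > 0, ∀ x y : G,
    (μ p {ω | Conn f ω x y}).toReal ≤ c * Real.exp (-γ * (wdist f x y : ℝ))}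

/-- The walk-through function `g(p,t) = 1 - ∑_{n≥1} (1-t)^{n-1} P_p(|C| = n)` of a Cayley
graph; here `μ` is the percolation measure at parameter `p`. -/
noncomputable def wt (f : ι → G) (μ : Measure (Config (G × ι))) (t : ℝ) : ℝ :=
  1 - ∑' n : ℕ, (1 - t) ^ n * (μ {ω | (cluster f ω).encard = ((n + 1 : ℕ) : ℕ∞)}).toReal

/-- The ball of radius `j`: all products of at most `j` elements of `S ∪ S⁻¹`. -/
def ball (S : Set G) (j : ℕ) : Set G :=
  {g | ∃ l : List G, l.length ≤ j ∧ (∀ x ∈ l, x ∈ S ∨ x⁻¹ ∈ S) ∧ l.prod = g}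

/-- The Cheeger constant `h = inf_K |∂K| / |K|`, the infimum over nonempty finite vertex
sets `K` of the number of edges `(a, i)` (joining `a` and `a * f i`) with exactly one
endpoint in `K`, divided by `|K|`. -/
noncomputable def cheeger (f : ι → G) : ℝ :=
  ⨅ K : {K : Finset G // K.Nonempty},
    (Nat.card {e : G × ι // Xor' (e.1 ∈ K.1) (e.1 * f e.2 ∈ K.1)} : ℝ) / (K.1.card : ℝ)

/-- The open cluster of the identity in the subgraph induced on the vertex set `V`: only
open edges with both endpoints in `V` may be used. -/
def clusterIn (f : ι → G) (V : Set G) (ω : Config (G × ι)) : Set G :=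
  {x | Relation.ReflTransGen (fun a b => Step f ω a b ∧ a ∈ V ∧ b ∈ V) 1 x}

/-- The generators of `G` given by a generating set `S` (one edge orbit per element
of `S`). -/
def setGens (S : Set G) : S → G := Subtype.val

/-- The generators of the free product `G₁ * G₂` given by the disjoint union `S₁ ⊔ S₂` of
generating sets, embedded via the canonical monomorphisms. -/
def coprodGens {G₁ G₂ : Type*} [Group G₁] [Group G₂] (S₁ : Set G₁) (S₂ : Set G₂) :
    S₁ ⊕ S₂ → Monoid.Coprod G₁ G₂ :=
  Sum.elim (fun s => Monoid.Coprod.inl (s : G₁)) (fun s => Monoid.Coprod.inr (s : G₂))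

/-- The generators of the free product `G₁ * ⋯ * G_n` given by the disjoint union
`S₁ ⊔ ⋯ ⊔ S_n` of generating sets, embedded via the canonical monomorphisms. -/
def coprodIGens {n : ℕ} {G : Fin n → Type*} [∀ i, Group (G i)] (S : ∀ i, Set (G i)) :
    (Σ i, S i) → Monoid.CoprodI G :=
  fun x => Monoid.CoprodI.of (x.2 : G x.1)

/-- The image of a list of syllables in the free product `G₁ * G₂`. -/
def sylProd {G₁ G₂ : Type*} [Group G₁] [Group G₂] (l : List (G₁ ⊕ G₂)) :
    Monoid.Coprod G₁ G₂ :=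
  (l.map (Sum.elim (fun g => Monoid.Coprod.inl g) (fun h => Monoid.Coprod.inr h))).prod

/-- The set `P₁` of nontrivial elements of `G₁ * G₂` whose normal form begins with a
nontrivial syllable of `G₁`: elements represented by a nonempty alternating product of
nontrivial syllables, the first syllable lying in `G₁`.  (Such a representation is the
normal form, which is unique.) -/
def beginsLeft {G₁ G₂ : Type*} [Group G₁] [Group G₂] (x : Monoid.Coprod G₁ G₂) : Prop :=
  ∃ l : List (G₁ ⊕ G₂), l ≠ [] ∧ (∀ a ∈ l, a ≠ Sum.inl 1 ∧ a ≠ Sum.inr 1) ∧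
    l.Chain' (fun a b => a.isLeft ≠ b.isLeft) ∧
    (∃ g : G₁, l.head? = some (Sum.inl g)) ∧ sylProd l = x

/-- The set `P₂` of nontrivial elements of `G₁ * G₂` whose normal form begins with a
nontrivial syllable of `G₂`. -/
def beginsRight {G₁ G₂ : Type*} [Group G₁] [Group G₂] (x : Monoid.Coprod G₁ G₂) : Prop :=
  ∃ l : List (G₁ ⊕ G₂), l ≠ [] ∧ (∀ a ∈ l, a ≠ Sum.inl 1 ∧ a ≠ Sum.inr 1) ∧
    l.Chain' (fun a b => a.isLeft ≠ b.isLeft) ∧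
    (∃ h : G₂, l.head? = some (Sum.inr h)) ∧ sylProd l = x

end Perc

open Perc

namespace Perc

section Bernoulli

variable {E E' : Type*}

/-- Inhomogeneous Bernoulli percolation: the edges are independent and the edge `e` is closed
with probability `r e`. -/
def IsBern (r : E → ℝ≥0∞) (ν : Measure (Config E)) : Prop :=
  ∀ F : Finset E, ν {ω | ∀ e ∈ F, ω e = false} = ∏ e ∈ F, r e

/-- The event that all edges of `F` are closed. -/
def closedOn (F : Finset E) : Set (Config E) := {ω | ∀ e ∈ F, ω e = false}

/-- The event `A` only depends on the states of the edges in `T`. -/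
def Dep (T : Set E) (A : Set (Config E)) : Prop :=
  ∀ ω ω' : Config E, (∀ e ∈ T, ω e = ω' e) → ω ∈ A → ω' ∈ A

lemma measurableSet_closedOn (F : Finset E) : MeasurableSet (closedOn F) := by
  have : closedOn F = ⋂ e ∈ F, (fun ω : Config E => ω e) ⁻¹' {false} := by
    ext ω; simp [closedOn]
  rw [this]
  exact Finset.measurableSet_biInter _ fun e _ => measurable_pi_apply e (measurableSet_singleton _)

lemma IsBern.isProbabilityMeasure {r : E → ℝ≥0∞} {ν : Measure (Config E)} (h : IsBern r ν) :
    IsProbabilityMeasure ν :=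
  ⟨by simpa using h ∅⟩

lemma isPiSystem_closedOn : IsPiSystem (Set.range (closedOn (E := E))) := by
  classical
  rintro _ ⟨F, rfl⟩ _ ⟨F', rfl⟩ -
  refine ⟨F ∪ F', ?_⟩
  ext ω
  simp only [closedOn, Finset.mem_union, Set.mem_ofPred_eq, Set.mem_inter_iff]
  grind

lemma generateFrom_closedOn :
    (MeasurableSpace.pi : MeasurableSpace (Config E)) =
      MeasurableSpace.generateFrom (Set.range (closedOn (E := E))) := by
  apply le_antisymm
  · refine iSup_le fun e => ?_
    rw [← measurable_iff_comap_le]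
    refine measurable_to_bool ?_
    have : (fun ω : Config E => ω e) ⁻¹' {true} = (closedOn {e})ᶜ := by
      ext ω; simp [closedOn]
    rw [this]
    exact (MeasurableSpace.measurableSet_generateFrom (Set.mem_range_self ({e} : Finset E))).compl
  · refine MeasurableSpace.generateFrom_le ?_
    rintro _ ⟨F, rfl⟩
    exact measurableSet_closedOn F

lemma IsBern.ext {r : E → ℝ≥0∞} {ν ν' : Measure (Config E)} (h : IsBern r ν)
    (h' : IsBern r ν') : ν = ν' := by
  have := h.isProbabilityMeasure
  have := h'.isProbabilityMeasure
  refine ext_of_generate_finite _ generateFrom_closedOn isPiSystem_closedOn ?_ (by simp)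
  rintro _ ⟨F, rfl⟩
  exact (h F).trans (h' F).symm

lemma measurable_pullback (φ : E' → E) : Measurable (fun (ω : Config E) (e : E') => ω (φ e)) :=
  measurable_pi_lambda _ fun e => measurable_pi_apply (φ e)

lemma IsBern.pullback {r : E → ℝ≥0∞} {ν : Measure (Config E)} (h : IsBern r ν) {φ : E' → E}
    (hφ : Function.Injective φ) :
    IsBern (fun e => r (φ e)) (ν.map fun ω e => ω (φ e)) := by
  intro F
  change (ν.map fun ω e => ω (φ e)) (closedOn F) = _
  rw [Measure.map_apply (measurable_pullback φ) (measurableSet_closedOn F)]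
  have := h (F.map ⟨φ, hφ⟩)
  rw [Finset.prod_map] at this
  rw [← show _ = ∏ e ∈ F, r (φ e) from this]
  congr 1
  ext ω
  simp [closedOn]

open Classical in
/-- Take the states of the edges in `T` from `ω.1`, the other ones from `ω.2`. -/
noncomputable def mix (T : Set E) (ω : Config E × Config E) : Config E :=
  fun e => if e ∈ T then ω.1 e else ω.2 e

lemma measurable_mix (T : Set E) : Measurable (mix T) := by
  classical
  refine measurable_pi_lambda _ fun e => ?_
  unfold mix
  by_cases h : e ∈ T
  · simpa [h, Function.comp_def] using (measurable_pi_apply e).comp measurable_fst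
  · simpa [h, Function.comp_def] using (measurable_pi_apply e).comp measurable_snd

lemma IsBern.map_mix {r : E → ℝ≥0∞} {ν : Measure (Config E)} (h : IsBern r ν) (T : Set E) :
    (ν.prod ν).map (mix T) = ν := by
  classical
  have := h.isProbabilityMeasure
  refine IsBern.ext (fun F => ?_) h
  change (Measure.map _ _) (closedOn F) = _
  rw [Measure.map_apply (measurable_mix T) (measurableSet_closedOn F)]
  have : mix T ⁻¹' closedOn F =
      closedOn (F.filter (· ∈ T)) ×ˢ closedOn (F.filter (· ∉ T)) := by
    ext ω
    simp only [closedOn, mix, Set.mem_preimage, Set.mem_ofPred_eq, Set.mem_prod, Finset.mem_filter]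
    grind
  rw [this, Measure.prod_prod, ← Finset.prod_filter_mul_prod_filter_not F (· ∈ T)]
  exact congrArg₂ _ (h _) (h _)

lemma IsBern.inter {r : E → ℝ≥0∞} {ν : Measure (Config E)} (h : IsBern r ν) {T T' : Set E}
    {A B : Set (Config E)} (hA : MeasurableSet A) (hB : MeasurableSet B) (dA : Dep T A)
    (dB : Dep T' B) (hT : ∀ e ∈ T, e ∉ T') : ν (A ∩ B) = ν A * ν B := by
  have := h.isProbabilityMeasure
  conv_lhs => rw [← h.map_mix T, Measure.map_apply (measurable_mix T) (hA.inter hB)]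
  rw [← Measure.prod_prod]
  congr 1
  ext ⟨ω, ω'⟩
  have h1 : mix T (ω, ω') ∈ A ↔ ω ∈ A :=
    ⟨dA _ _ fun e he => by simp [mix, he], dA _ _ fun e he => by simp [mix, he]⟩
  have h2 : mix T (ω, ω') ∈ B ↔ ω' ∈ B := by
    have : ∀ e ∈ T', e ∉ T := fun e he he' => hT e he' he
    exact ⟨dB _ _ fun e he => by simp [mix, this e he], dB _ _ fun e he => by simp [mix, this e he]⟩
  simp [h1, h2]

lemma measurable_sumElim :
    Measurable (fun ω : Config E × Config E' => (Sum.elim ω.1 ω.2 : Config (E ⊕ E'))) := by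
  refine measurable_pi_lambda _ fun e => ?_
  rcases e with e | e
  · exact (measurable_pi_apply e).comp measurable_fst
  · exact (measurable_pi_apply e).comp measurable_snd

lemma IsBern.sum {r : E → ℝ≥0∞} {r' : E' → ℝ≥0∞} {ν : Measure (Config E)}
    {ν' : Measure (Config E')} (h : IsBern r ν) (h' : IsBern r' ν') :
    IsBern (Sum.elim r r')
      ((ν.prod ν').map fun ω => (Sum.elim ω.1 ω.2 : Config (E ⊕ E'))) := by
  have := h.isProbabilityMeasure
  have := h'.isProbabilityMeasure
  intro F
  change (Measure.map _ _) (closedOn F) = _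
  rw [Measure.map_apply measurable_sumElim (measurableSet_closedOn F)]
  have : (fun ω : Config E × Config E' => (Sum.elim ω.1 ω.2 : Config (E ⊕ E'))) ⁻¹' closedOn F =
      closedOn F.toLeft ×ˢ closedOn F.toRight := by
    ext ω
    simp [closedOn]
  rw [this, Measure.prod_prod, ← Finset.toLeft_disjSum_toRight (u := F), Finset.prod_disjSum]
  simp only [Finset.toLeft_disjSum_toRight, Sum.elim_inl, Sum.elim_inr]
  exact congrArg₂ _ (h _) (h' _)

lemma measurable_sup :
    Measurable (fun ξ : Config (E ⊕ E) => (fun e => ξ (Sum.inl e) || ξ (Sum.inr e) : Config E)) :=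
  measurable_pi_lambda _ fun e =>
    have h : Measurable fun ξ : Config (E ⊕ E) => (ξ (Sum.inl e), ξ (Sum.inr e)) :=
      (measurable_pi_apply (Sum.inl e)).prodMk (measurable_pi_apply (Sum.inr e))
    (measurable_of_countable fun b : Bool × Bool => b.1 || b.2).comp h

lemma IsBern.sup {r : E ⊕ E → ℝ≥0∞} {ν : Measure (Config (E ⊕ E))} (h : IsBern r ν) :
    IsBern (fun e => r (Sum.inl e) * r (Sum.inr e))
      (ν.map fun ξ e => ξ (Sum.inl e) || ξ (Sum.inr e)) := by
  intro F
  change (Measure.map _ _) (closedOn F) = _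
  rw [Measure.map_apply measurable_sup (measurableSet_closedOn F), Finset.prod_mul_distrib]
  have := h (F.disjSum F)
  rw [Finset.prod_disjSum] at this
  rw [← this]
  congr 1
  ext ω
  simp [closedOn]
  grind

lemma IsBernoulli.isBern {p : ℝ} {μ : Measure (Config E)} (h : IsBernoulli p μ) :
    IsBern (fun _ => ENNReal.ofReal (1 - p)) μ := fun F => by
  simpa using h F fun _ => false

lemma measurable_not : Measurable (fun (ω : Config E) e => !ω e) :=
  measurable_pi_lambda _ fun e =>
    (measurable_of_countable fun b : Bool => !b).comp (measurable_pi_apply e)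

lemma IsBernoulli.map_not {p : ℝ} {μ : Measure (Config E)} (h : IsBernoulli p μ) :
    IsBern (fun _ => ENNReal.ofReal p) (μ.map fun ω e => !ω e) := fun F => by
  change (Measure.map _ _) (closedOn F) = _
  rw [Measure.map_apply measurable_not (measurableSet_closedOn F)]
  simpa [closedOn] using h F fun _ => true

lemma measurable_inf :
    Measurable (fun ω : Config E × Config E => (fun e => ω.1 e && ω.2 e : Config E)) :=
  measurable_pi_lambda _ fun e =>
    have h : Measurable fun ω : Config E × Config E => (ω.1 e, ω.2 e) :=
      ((measurable_pi_apply e).comp measurable_fst).prodMk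
        ((measurable_pi_apply e).comp measurable_snd)
    (measurable_of_countable fun b : Bool × Bool => b.1 && b.2).comp h

lemma IsBernoulli.map_inf {p s : ℝ} {μ μ' μ'' : Measure (Config E)} (hp : 0 ≤ p)
    (h : IsBernoulli p μ) (h' : IsBernoulli s μ') (h'' : IsBernoulli (p * s) μ'') :
    (μ.prod μ').map (fun ω e => ω.1 e && ω.2 e) = μ'' := by
  have i1 := h.isBern.isProbabilityMeasure
  have i2 := h'.isBern.isProbabilityMeasure
  have key : ((μ.prod μ').map (fun ω e => ω.1 e && ω.2 e)).map (fun ω e => !ω e) =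
      μ''.map (fun ω e => !ω e) := by
    refine IsBern.ext (fun F => ?_) h''.map_not
    change (Measure.map _ _) (closedOn F) = _
    rw [Measure.map_map measurable_not measurable_inf,
      Measure.map_apply (measurable_not.comp measurable_inf) (measurableSet_closedOn F)]
    have : ((fun (ω : Config E) e => !ω e) ∘
        fun ω : Config E × Config E => (fun e => ω.1 e && ω.2 e : Config E)) ⁻¹' closedOn F =
        {ω | ∀ e ∈ F, ω e = (fun _ => true) e} ×ˢ {ω | ∀ e ∈ F, ω e = (fun _ => true) e} := by
      ext ω
      simp [closedOn]
      grind
    rw [this, Measure.prod_prod, h, h']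
    simp [ENNReal.ofReal_mul hp, mul_pow]
  have := congrArg (Measure.map fun ω e => !ω e) key
  rw [Measure.map_map measurable_not measurable_not,
    Measure.map_map measurable_not measurable_not] at this
  have hid : ((fun (ω : Config E) e => !ω e) ∘ fun (ω : Config E) e => !ω e) = id := by
    ext; simp
  simpa [hid] using this

end Bernoulli

end Perc

namespace Perc

section Connectivity

variable {E G ι : Type*} [Group G]

open Classical in
/-- The configuration obtained from `ω` by closing all edges outside `U`. -/
noncomputable def restr (U : Set E) (ω : Config E) : Config E := fun e => ω e && decide (e ∈ U)

lemma restr_eq_true {U : Set E} {ω : Config E} {e : E} :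
    restr U ω e = true ↔ ω e = true ∧ e ∈ U := by
  simp [restr]

lemma measurable_restr (U : Set E) : Measurable (restr U) :=
  measurable_pi_lambda _ fun e =>
    (measurable_of_countable fun b : Bool => b && _).comp (measurable_pi_apply e)

lemma Step.mono {f : ι → G} {ω ω' : Config (G × ι)} (h : ∀ e, ω e = true → ω' e = true) {x y : G}
    (hs : Step f ω x y) : Step f ω' x y := by
  obtain ⟨i, hi⟩ := hs
  exact ⟨i, hi.imp (And.imp_left (h _)) (And.imp_left (h _))⟩

lemma Conn.mono {f : ι → G} {ω ω' : Config (G × ι)} (h : ∀ e, ω e = true → ω' e = true) {x y : G}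
    (hc : Conn f ω x y) : Conn f ω' x y :=
  Relation.ReflTransGen.mono (fun _ _ => Step.mono h) x y hc

lemma Conn.exists_finset {f : ι → G} {ω : Config (G × ι)} {x y : G} (h : Conn f ω x y) :
    ∃ F : Finset (G × ι), Conn f (restr F ω) x y := by
  classical
  induction h with
  | refl => exact ⟨∅, .refl⟩
  | @tail y z _ hs ih =>
    obtain ⟨F, hF⟩ := ih
    have key (e : G × ι) : ∀ e', restr F ω e' = true → restr (insert e F : Finset _) ω e' = true := by
      intro e'
      simp only [restr_eq_true, Finset.coe_insert, Set.mem_insert_iff]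
      tauto
    obtain ⟨i, ⟨hi, rfl⟩ | ⟨hi, rfl⟩⟩ := hs
    · exact ⟨insert (y, i) F, (hF.mono (key _)).tail ⟨i, .inl ⟨by simp [restr_eq_true, hi], rfl⟩⟩⟩
    · exact ⟨insert (z, i) F, (hF.mono (key _)).tail ⟨i, .inr ⟨by simp [restr_eq_true, hi], rfl⟩⟩⟩

lemma measurableSet_conn [Countable G] [Countable ι] (f : ι → G) (x y : G) :
    MeasurableSet {ω | Conn f ω x y} := by
  refine IsOpen.measurableSet (isOpen_iff_mem_nhds.2 fun ω h => ?_)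
  have hopen (e : G × ι) (he : ω e = true) : ∀ᶠ ω' in nhds ω, ω' e = true :=
    (continuous_apply (A := fun _ => Bool) e).continuousAt.eventually
      ((isOpen_discrete {true}).mem_nhds he)
  change ∀ᶠ ω' in nhds ω, Conn f ω' x y
  induction h with
  | refl => exact .of_forall fun _ => .refl
  | @tail y z _ hs ih =>
    obtain ⟨i, ⟨hi, rfl⟩ | ⟨hi, rfl⟩⟩ := hs
    · filter_upwards [ih, hopen _ hi] with ω' h1 h2 using h1.tail ⟨i, .inl ⟨h2, rfl⟩⟩
    · filter_upwards [ih, hopen _ hi] with ω' h1 h2 using h1.tail ⟨i, .inr ⟨h2, rfl⟩⟩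

lemma measure_conn_eq_iSup [Countable G] [Countable ι] (f : ι → G) (ν : Measure (Config (G × ι)))
    (x y : G) :
    ν {ω | Conn f ω x y} = ⨆ F : Finset (G × ι), ν {ω | Conn f (restr F ω) x y} := by
  have h : {ω | Conn f ω x y} = ⋃ F : Finset (G × ι), {ω | Conn f (restr F ω) x y} := by
    ext ω
    simp only [Set.mem_ofPred_eq, Set.mem_iUnion]
    exact ⟨Conn.exists_finset, fun ⟨F, hF⟩ => hF.mono fun e he => (restr_eq_true.1 he).1⟩
  rw [h, Directed.measure_iUnion]
  refine directed_of_isDirected_le fun F F' hF ω => Conn.mono fun e he => ?_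
  rw [restr_eq_true] at he ⊢
  exact ⟨he.1, hF he.2⟩

lemma encard_cluster_eq_tsum (f : ι → G) (ω : Config (G × ι)) :
    ((cluster f ω).encard : ℝ≥0∞) = ∑' y, {ω | Conn f ω 1 y}.indicator 1 ω := by
  rw [← ENNReal.tsum_set_one, tsum_subtype (cluster f ω) fun _ => (1 : ℝ≥0∞)]
  rfl

lemma chi_eq_tsum [Countable G] [Countable ι] (f : ι → G) (ν : Measure (Config (G × ι))) :
    chi f ν = ∑' y, ν {ω | Conn f ω 1 y} := by
  simp_rw [chi, encard_cluster_eq_tsum]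
  rw [lintegral_tsum fun y => (measurable_one.indicator (measurableSet_conn f 1 y)).aemeasurable]
  simp_rw [lintegral_indicator_one (measurableSet_conn f 1 _)]

lemma Conn.map {A κ : Type*} [Group A] {f : ι → G} {g : κ → A} {ω : Config (G × ι)}
    {ω' : Config (A × κ)} {φ : A → G} {j : κ → ι} (hφ : ∀ a k, φ (a * g k) = φ a * f (j k))
    (hω : ∀ a k, ω' (a, k) = true → ω (φ a, j k) = true) {x y : A} (h : Conn g ω' x y) :
    Conn f ω (φ x) (φ y) := by
  refine Relation.ReflTransGen.lift φ (fun a b hab => ?_) x y h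
  obtain ⟨k, ⟨hk, rfl⟩ | ⟨hk, rfl⟩⟩ := hab
  · exact ⟨j k, .inl ⟨hω _ _ hk, hφ _ _⟩⟩
  · exact ⟨j k, .inr ⟨hω _ _ hk, hφ _ _⟩⟩

/-- The configuration seen from the vertex `z`. -/
def shift (z : G) (ω : Config (G × ι)) : Config (G × ι) := fun e => ω (z * e.1, e.2)

lemma measurable_shift (z : G) : Measurable (shift (ι := ι) z) :=
  measurable_pullback fun e : G × ι => (z * e.1, e.2)

lemma IsBern.map_shift {r : ℝ≥0∞} {ν : Measure (Config (G × ι))} (h : IsBern (fun _ => r) ν)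
    (z : G) : ν.map (shift z) = ν :=
  (h.pullback (φ := fun e : G × ι => (z * e.1, e.2)) fun a b hab => by
    simpa [Prod.ext_iff] using hab).ext h

lemma conn_shift {f : ι → G} {ω : Config (G × ι)} {z x y : G} :
    Conn f (shift z ω) x y ↔ Conn f ω (z * x) (z * y) := by
  refine ⟨Conn.map (φ := (z * ·)) (j := id) (fun a k => by simp [mul_assoc]) fun a k => id,
    fun h => ?_⟩
  have := Conn.map (f := f) (ω := shift z ω) (φ := (z⁻¹ * ·)) (j := id)
    (fun a k => by simp [mul_assoc]) (fun a k hk => by simpa [shift] using hk) h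
  simpa using this

lemma IsBern.measure_conn [Countable G] [Countable ι] {f : ι → G} {r : ℝ≥0∞}
    {ν : Measure (Config (G × ι))} (h : IsBern (fun _ => r) ν) (x y : G) :
    ν {ω | Conn f ω x y} = ν {ω | Conn f ω 1 (x⁻¹ * y)} := by
  conv_rhs => rw [← h.map_shift x, Measure.map_apply (measurable_shift x) (measurableSet_conn _ _ _)]
  simp [conn_shift]

lemma IsBern.tsum_measure_conn [Countable G] [Countable ι] {f : ι → G} {r : ℝ≥0∞}
    {ν : Measure (Config (G × ι))} (h : IsBern (fun _ => r) ν) (x : G) :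
    ∑' y, ν {ω | Conn f ω x y} = chi f ν := by
  simp_rw [chi_eq_tsum, h.measure_conn x]
  exact (Equiv.mulLeft x⁻¹).tsum_eq fun y => ν {ω | Conn f ω 1 y}

/-- The expected number of vertices different from `1` in the cluster of `1`. -/
noncomputable def chi' (f : ι → G) (ν : Measure (Config (G × ι))) : ℝ≥0∞ :=
  ∑' y : {y : G // y ≠ 1}, ν {ω | Conn f ω 1 y}

lemma chi_eq_one_add [Countable G] [Countable ι] (f : ι → G) (ν : Measure (Config (G × ι)))
    [IsProbabilityMeasure ν] : chi f ν = 1 + chi' f ν := by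
  classical
  rw [chi_eq_tsum, ENNReal.tsum_eq_add_tsum_ite 1, chi']
  refine congrArg₂ _ ?_ (Eq.trans ?_
    (tsum_subtype {y : G | y ≠ 1} fun y => ν {ω | Conn f ω 1 y}).symm)
  · have : {ω | Conn f ω 1 1} = Set.univ := Set.eq_univ_of_forall fun ω => .refl
    rw [this, measure_univ]
  · refine tsum_congr fun y => ?_
    by_cases h : y = 1 <;> simp [h, Set.indicator]

lemma chi_sub_one [Countable G] [Countable ι] (f : ι → G) (ν : Measure (Config (G × ι)))
    [IsProbabilityMeasure ν] : chi f ν - 1 = chi' f ν := by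
  rw [chi_eq_one_add]
  exact ENNReal.add_sub_cancel_left one_ne_top

lemma IsBernoulli.pow_mul_measure_conn_le [Countable G] [Countable ι] {f : ι → G} {p s : ℝ}
    {μ μ' μ'' : Measure (Config (G × ι))} (hp : 0 ≤ p)
    (h : IsBernoulli p μ) (h' : IsBernoulli s μ') (h'' : IsBernoulli (p * s) μ'')
    (F : Finset (G × ι)) (x y : G) :
    ENNReal.ofReal s ^ F.card * μ {ω | Conn f (restr F ω) x y} ≤ μ'' {ω | Conn f ω x y} := by
  have := h.isBern.isProbabilityMeasure
  have := h'.isBern.isProbabilityMeasure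
  rw [← h.map_inf hp h' h'', Measure.map_apply measurable_inf (measurableSet_conn f x y)]
  have h1 := h' F fun _ => true
  simp only [if_true, Finset.prod_const] at h1
  rw [← h1, mul_comm, ← Measure.prod_prod]
  refine measure_mono fun ω hω => ?_
  refine Conn.mono (fun e he => ?_) hω.1
  have he' := restr_eq_true.1 he
  simp [he'.1, hω.2 e he'.2]

lemma IsBernoulli.measure_conn_le_mul [Countable G] [Finite ι] {f : ι → G} {p s : ℝ}
    {μ μ' μ'' : Measure (Config (G × ι))} (hp : 0 ≤ p)
    (h : IsBernoulli p μ) (h' : IsBernoulli s μ') (h'' : IsBernoulli (p * s) μ'') :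
    ∃ n : ℕ, ∀ x ≠ 1, μ'' {ω | Conn f ω 1 x} ≤
      (1 - ENNReal.ofReal (1 - s) ^ n) * μ {ω | Conn f ω 1 x} := by
  classical
  have := Fintype.ofFinite ι
  have := h.isBern.isProbabilityMeasure
  have := h'.isBern.isProbabilityMeasure
  let F : Finset (G × ι) := Finset.univ.image (fun i => (1, i)) ∪
    Finset.univ.image (fun i => ((f i)⁻¹, i))
  refine ⟨F.card, fun x hx => ?_⟩
  rw [← h.map_inf hp h' h'', Measure.map_apply measurable_inf (measurableSet_conn f 1 x)]
  have h1 : μ' (closedOn F)ᶜ = 1 - ENNReal.ofReal (1 - s) ^ F.card := by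
    rw [prob_compl_eq_one_sub (measurableSet_closedOn F)]
    congr 1
    exact (h'.isBern F).trans (by simp)
  rw [← h1, mul_comm, ← Measure.prod_prod]
  refine measure_mono fun ω hω => ⟨Conn.mono (fun e he => ?_) hω, fun hcl => ?_⟩
  · simp_all
  · rcases Relation.ReflTransGen.cases_head hω with h0 | ⟨c, ⟨i, hi⟩, -⟩
    · exact hx h0.symm
    · have e1 := hcl (1, i) (by simp [F])
      have e2 := hcl ((f i)⁻¹, i) (by simp [F])
      rcases hi with ⟨hi, -⟩ | ⟨hi, hc⟩
      · simp [e1] at hi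
      · rw [← eq_inv_of_mul_eq_one_left hc.symm] at e2
        simp [e2] at hi

end Connectivity

end Perc

namespace Perc

section Susceptibility

variable {G ι : Type*} [Group G]

/-- The edges with at least one endpoint in `A`. -/
def touching (f : ι → G) (A : Set G) : Set (G × ι) := {e | e.1 ∈ A ∨ e.1 * f e.2 ∈ A}

/-- The edge at `a` in direction `d`. -/
def edgeAt (f : ι → G) (a : G) (d : ι × Bool) : G × ι :=
  if d.2 then (a, d.1) else (a * (f d.1)⁻¹, d.1)

/-- The neighbour of `a` in direction `d`. -/
def nbr (f : ι → G) (a : G) (d : ι × Bool) : G :=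
  if d.2 then a * f d.1 else a * (f d.1)⁻¹

lemma edgeAt_mem_touching (f : ι → G) {A : Set G} {a : G} (ha : a ∈ A) (d : ι × Bool) :
    edgeAt f a d ∈ touching f A := by
  unfold edgeAt touching
  split_ifs <;> simp [ha]

lemma exists_last_exit {X : Type*} {R : X → X → Prop} {A : Set X} {x y : X}
    (h : Relation.ReflTransGen R x y) (hx : x ∈ A) (hy : y ∉ A) :
    ∃ a ∈ A, ∃ c ∉ A, R a c ∧ Relation.ReflTransGen (fun u v => R u v ∧ u ∉ A ∧ v ∉ A) c y := by
  induction h with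
  | refl => exact absurd hx hy
  | @tail y z _ hs ih =>
    by_cases hyA : y ∈ A
    · exact ⟨y, hyA, z, hy, hs, .refl⟩
    · obtain ⟨a, ha, c, hc, h1, h2⟩ := ih hyA
      exact ⟨a, ha, c, hc, h1, h2.tail ⟨hs, hyA, hy⟩⟩

lemma Conn.avoiding {f : ι → G} {ω : Config (G × ι)} {A : Set G} {U : Set (G × ι)} {c y : G}
    (h : Relation.ReflTransGen (fun u v => Step f (restr U ω) u v ∧ u ∉ A ∧ v ∉ A) c y) :
    Conn f (restr (U \ touching f A) ω) c y := by
  refine Relation.ReflTransGen.mono (fun u v huv => ?_) _ _ h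
  obtain ⟨⟨i, ⟨hi, rfl⟩ | ⟨hi, rfl⟩⟩, hu, hv⟩ := huv <;> rw [restr_eq_true] at hi
  · exact ⟨i, .inl ⟨restr_eq_true.2 ⟨hi.1, hi.2, fun h => h.elim hu hv⟩, rfl⟩⟩
  · exact ⟨i, .inr ⟨restr_eq_true.2 ⟨hi.1, hi.2, fun h => h.elim hv hu⟩, rfl⟩⟩

lemma exists_finset_conn_restr (f : ι → G) (F : Finset (G × ι)) (b : G) :
    ∃ K : Finset G, K.card ≤ 2 * F.card + 1 ∧ ∀ ω x, Conn f (restr F ω) b x → x ∈ K := by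
  classical
  refine ⟨insert b (F.image Prod.fst ∪ F.image fun e => e.1 * f e.2), ?_, fun ω x h => ?_⟩
  · have h1 := Finset.card_insert_le b (F.image Prod.fst ∪ F.image fun e => e.1 * f e.2)
    have h2 := Finset.card_union_le (F.image Prod.fst) (F.image fun e => e.1 * f e.2)
    have h3 := Finset.card_image_le (s := F) (f := Prod.fst)
    have h4 := Finset.card_image_le (s := F) (f := fun e => e.1 * f e.2)
    omega
  · rcases Relation.ReflTransGen.cases_tail h with h0 | ⟨c, -, i, ⟨hi, rfl⟩ | ⟨hi, rfl⟩⟩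
    · simp [h0]
    · have := (restr_eq_true.1 hi).2
      simp only [Finset.mem_insert, Finset.mem_union, Finset.mem_image]
      exact .inr (.inr ⟨_, this, rfl⟩)
    · have := (restr_eq_true.1 hi).2
      simp only [Finset.mem_insert, Finset.mem_union, Finset.mem_image]
      exact .inr (.inl ⟨_, this, rfl⟩)

/-- The first layer of a pair of configurations. -/
def lower {E : Type*} (ξ : Config (E ⊕ E)) : Config E := fun e => ξ (Sum.inl e)

/-- The union of the two layers of a pair of configurations. -/
def upper {E : Type*} (ξ : Config (E ⊕ E)) : Config E := fun e => ξ (Sum.inl e) || ξ (Sum.inr e)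

/-- The event that `A` is the cluster of `b` in the first layer, restricted to `F`. -/
def clusterEq (f : ι → G) (F : Finset (G × ι)) (b : G) (A : Finset G) :
    Set (Config (G × ι ⊕ G × ι)) :=
  {ξ | ∀ x, Conn f (restr F (lower ξ)) b x ↔ x ∈ A}

lemma measurable_lower {E : Type*} : Measurable (lower (E := E)) := measurable_pullback Sum.inl

lemma measurable_upper {E : Type*} : Measurable (upper (E := E)) := measurable_sup

lemma measurableSet_clusterEq [Countable G] [Countable ι] (f : ι → G) (F : Finset (G × ι)) (b : G)
    (A : Finset G) : MeasurableSet (clusterEq f F b A) := by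
  refine MeasurableSet.congr (MeasurableSet.iInter fun x : G =>
    (((measurableSet_conn f b x).preimage
      ((measurable_restr (F : Set (G × ι))).comp measurable_lower)).iff
        (MeasurableSet.const (x ∈ A)))) ?_
  ext ξ
  simp [clusterEq]

lemma measurableSet_conn_upper [Countable G] [Countable ι] (f : ι → G) (U : Set (G × ι))
    (b x : G) : MeasurableSet {ξ | Conn f (restr U (upper ξ)) b x} :=
  (measurableSet_conn f b x).preimage ((measurable_restr U).comp measurable_upper)

lemma dep_clusterEq (f : ι → G) (F : Finset (G × ι)) (b : G) (A : Finset G) :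
    Dep (Sum.inl '' touching f A) (clusterEq f F b A) := by
  intro ξ ξ' h hξ
  have hb : b ∈ A := (hξ b).1 .refl
  have hs {u v : G} (hu : u ∈ A ∨ v ∈ A) :
      Step f (restr F (lower ξ)) u v ↔ Step f (restr F (lower ξ')) u v := by
    have key {e : G × ι} (he : e ∈ touching f A) : lower ξ e = lower ξ' e :=
      h _ ⟨e, he, rfl⟩
    refine exists_congr fun i => or_congr (and_congr_left ?_) (and_congr_left ?_)
    · rintro rfl
      rw [restr_eq_true, restr_eq_true, key hu]
    · rintro rfl
      rw [restr_eq_true, restr_eq_true, key hu.symm]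
  intro x
  constructor
  · intro hx
    induction hx with
    | refl => exact hb
    | tail _ h1 ih => exact (hξ _).1 (((hξ _).2 ih).tail ((hs (.inl ih)).2 h1))
  · intro hx
    have hx' := (hξ x).2 hx
    clear hx
    induction hx' with
    | refl => exact .refl
    | tail h0 h1 ih => exact ih.tail ((hs (.inl ((hξ _).1 h0))).1 h1)

lemma dep_conn_upper (f : ι → G) (F T : Set (G × ι)) (c x : G) :
    Dep {e | ∀ e' ∈ T, e ≠ Sum.inl e' ∧ e ≠ Sum.inr e'}
      {ξ | Conn f (restr (F \ T) (upper ξ)) c x} := by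
  intro ξ ξ' h hξ
  refine Conn.mono (fun e he => ?_) hξ
  rw [restr_eq_true] at he ⊢
  refine ⟨?_, he.2⟩
  rw [← he.1]
  have h1 := h (Sum.inl e) fun e' he' => ⟨by rintro ⟨⟩; exact he.2.2 he', by simp⟩
  have h2 := h (Sum.inr e) fun e' he' => ⟨by simp, by rintro ⟨⟩; exact he.2.2 he'⟩
  simp [upper, h1, h2]

lemma conn_upper_subset (f : ι → G) (F : Finset (G × ι)) (b x : G) :
    {ξ | Conn f (restr F (upper ξ)) b x} ⊆
      ⋃ A : Finset G, {ξ ∈ clusterEq f F b A | x ∈ A} ∪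
        ⋃ a ∈ A, ⋃ d : ι × Bool, (clusterEq f F b A ∩ {ξ | ξ (Sum.inr (edgeAt f a d)) = true}) ∩
          {ξ | Conn f (restr (F \ touching f A) (upper ξ)) (nbr f a d) x} := by
  classical
  intro ξ hξ
  obtain ⟨K, -, hK⟩ := exists_finset_conn_restr f F b
  let A := K.filter fun x => Conn f (restr F (lower ξ)) b x
  have hA : ξ ∈ clusterEq f F b A := fun y => by
    simp only [A, Finset.mem_filter]
    exact ⟨fun h => ⟨hK _ _ h, h⟩, fun h => h.2⟩
  refine Set.mem_iUnion.2 ⟨A, ?_⟩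
  by_cases hx : x ∈ A
  · exact .inl ⟨hA, hx⟩
  · right
    obtain ⟨a, ha, c, hc, hs, hcx⟩ := exists_last_exit (A := (A : Set G)) hξ ((hA b).1 .refl) hx
    have hcx := Conn.avoiding hcx
    have hclosed {e : G × ι} (h : Step f (restr F (lower ξ)) a c → False)
        (h' : restr F (lower ξ) e = true → Step f (restr F (lower ξ)) a c)
        (he : restr F (upper ξ) e = true) : ξ (Sum.inr e) = true := by
      rw [restr_eq_true] at he
      by_contra h3
      refine h (h' (restr_eq_true.2 ⟨?_, he.2⟩))
      have := he.1
      simpa [upper, lower, h3] using this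
    have hno : Step f (restr F (lower ξ)) a c → False := fun h =>
      hc ((hA c).1 (((hA a).2 ha).tail h))
    simp only [Set.mem_iUnion]
    obtain ⟨i, ⟨hi, rfl⟩ | ⟨hi, rfl⟩⟩ := hs
    · exact ⟨a, ha, (i, true), ⟨hA, hclosed hno (fun h => ⟨i, .inl ⟨h, rfl⟩⟩) hi⟩, hcx⟩
    · have e1 : edgeAt f (c * f i) (i, false) = (c, i) := by simp [edgeAt]
      have e2 : nbr f (c * f i) (i, false) = c := by simp [nbr]
      refine ⟨c * f i, ha, (i, false), ⟨hA, ?_⟩, by rwa [e2]⟩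
      rw [Set.mem_ofPred_eq, e1]
      exact hclosed hno (fun h => ⟨i, .inr ⟨h, rfl⟩⟩) hi

lemma measure_exit_le [Countable G] [Countable ι] {f : ι → G} {r t : ℝ≥0∞}
    {π : Measure (Config (G × ι ⊕ G × ι))} (h : IsBern (Sum.elim (fun _ => r) fun _ => t) π)
    (F : Finset (G × ι)) (b x : G) {A : Finset G} {a : G} (ha : a ∈ A) (d : ι × Bool) :
    π ((clusterEq f F b A ∩ {ξ | ξ (Sum.inr (edgeAt f a d)) = true}) ∩
      {ξ | Conn f (restr (F \ touching f A) (upper ξ)) (nbr f a d) x}) ≤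
    π (clusterEq f F b A) * (1 - t) * π {ξ | Conn f (restr F (upper ξ)) (nbr f a d) x} := by
  have := h.isProbabilityMeasure
  have hm : MeasurableSet {ξ : Config (G × ι ⊕ G × ι) | ξ (Sum.inr (edgeAt f a d)) = true} :=
    (measurableSet_singleton true).preimage (measurable_pi_apply (Sum.inr (edgeAt f a d)))
  have hd : Dep {Sum.inr (edgeAt f a d)}
      {ξ : Config (G × ι ⊕ G × ι) | ξ (Sum.inr (edgeAt f a d)) = true} := fun ξ ξ' h hξ =>
    (h _ rfl).symm.trans hξ
  have hc := measurableSet_clusterEq f F b A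
  have hT := edgeAt_mem_touching f (A := (A : Set G)) ha d
  have hdep : Dep {e | ∃ e' ∈ touching f (A : Set G), e = Sum.inl e' ∨ e = Sum.inr e'}
      (clusterEq f F b A ∩ {ξ | ξ (Sum.inr (edgeAt f a d)) = true}) := fun ξ ξ' h hξ =>
    ⟨dep_clusterEq f F b A ξ ξ' (by rintro _ ⟨e, he, rfl⟩; exact h _ ⟨e, he, .inl rfl⟩) hξ.1,
      hd ξ ξ' (by rintro _ rfl; exact h _ ⟨_, hT, .inr rfl⟩) hξ.2⟩
  rw [h.inter (hc.inter hm) (measurableSet_conn_upper f _ _ _) hdep (dep_conn_upper f _ _ _ _)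
    (by rintro e ⟨e', he', h1⟩ h2; exact h1.elim (h2 e' he').1 (h2 e' he').2),
    h.inter hc hm (dep_clusterEq f F b A) hd (by rintro _ ⟨e, he, rfl⟩; simp)]
  have h1 : π {ξ : Config (G × ι ⊕ G × ι) | ξ (Sum.inr (edgeAt f a d)) = true} = 1 - t := by
    have h2 := h {Sum.inr (edgeAt f a d)}
    have h3 := prob_compl_eq_one_sub (μ := π) (measurableSet_closedOn {Sum.inr (edgeAt f a d)})
    rw [show π (closedOn {Sum.inr (edgeAt f a d)}) = t from h2.trans (by simp)] at h3
    rw [← h3]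
    congr 1
    ext ξ
    simp [closedOn]
  rw [h1]
  gcongr
  intro hs
  refine Conn.mono (fun e he => ?_) hs
  rw [restr_eq_true] at he ⊢
  exact ⟨he.1, he.2.1⟩

lemma tsum_conn_upper_le [Countable G] [Fintype ι] {f : ι → G} {r t : ℝ≥0∞}
    {ν : Measure (Config (G × ι))} (hν : IsBern (fun _ => r) ν)
    {π : Measure (Config (G × ι ⊕ G × ι))} (h : IsBern (Sum.elim (fun _ => r) fun _ => t) π)
    (F : Finset (G × ι)) (b : G) :
    ∑' x, π {ξ | Conn f (restr F (upper ξ)) b x} ≤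
      chi f ν * (1 + 2 * Fintype.card ι * (1 - t) *
        ⨆ c, ∑' x, π {ξ | Conn f (restr F (upper ξ)) c x}) := by
  classical
  set s := ⨆ c, ∑' x, π {ξ | Conn f (restr F (upper ξ)) c x} with hs
  have hsize : ∑' A : Finset G, π (clusterEq f F b A) * A.card ≤ chi f ν := by
    have h1 (A : Finset G) : π (clusterEq f F b A) * A.card =
        ∑' x, π {ξ ∈ clusterEq f F b A | x ∈ A} := by
      rw [tsum_eq_sum (s := A) fun x hx => by simp [hx],
        Finset.sum_congr rfl (g := fun _ => π (clusterEq f F b A)) fun x hx => by simp [hx]]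
      simp [mul_comm]
    simp_rw [h1]
    rw [ENNReal.tsum_comm, ← hν.tsum_measure_conn b]
    refine ENNReal.tsum_le_tsum fun x => ?_
    rw [← measure_iUnion]
    · have hν' : π.map lower = ν := (h.pullback Sum.inl_injective).ext hν
      rw [← hν', Measure.map_apply measurable_lower (measurableSet_conn f b x)]
      refine measure_mono (Set.iUnion_subset fun A ξ hξ => ?_)
      exact Conn.mono (fun e he => (restr_eq_true.1 he).1) ((hξ.1 x).2 hξ.2)
    · intro A A' hAA'
      refine Set.disjoint_left.2 fun ξ hξ hξ' => hAA' ?_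
      ext y
      exact (hξ.1 y).symm.trans (hξ'.1 y)
    · intro A
      exact (measurableSet_clusterEq f F b A).inter (MeasurableSet.const (x ∈ A))
  have hx (x : G) : π {ξ | Conn f (restr F (upper ξ)) b x} ≤
      ∑' A : Finset G, (π {ξ ∈ clusterEq f F b A | x ∈ A} + ∑ a ∈ A, ∑ d : ι × Bool,
        π (clusterEq f F b A) * (1 - t) * π {ξ | Conn f (restr F (upper ξ)) (nbr f a d) x}) := by
    refine (measure_mono (conn_upper_subset f F b x)).trans ((measure_iUnion_le _).trans ?_)
    refine ENNReal.tsum_le_tsum fun A => (measure_union_le _ _).trans ?_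
    gcongr
    refine (measure_biUnion_finset_le _ _).trans (Finset.sum_le_sum fun a ha => ?_)
    exact (measure_iUnion_fintype_le _ _).trans
      (Finset.sum_le_sum fun d _ => measure_exit_le h F b x ha d)
  calc ∑' x, π {ξ | Conn f (restr F (upper ξ)) b x}
      ≤ ∑' x, ∑' A : Finset G, (π {ξ ∈ clusterEq f F b A | x ∈ A} + ∑ a ∈ A, ∑ d : ι × Bool,
        π (clusterEq f F b A) * (1 - t) *
          π {ξ | Conn f (restr F (upper ξ)) (nbr f a d) x}) := ENNReal.tsum_le_tsum hx
    _ ≤ ∑' A : Finset G, π (clusterEq f F b A) * A.card *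
          (1 + 2 * Fintype.card ι * (1 - t) * s) := by
        rw [ENNReal.tsum_comm]
        refine ENNReal.tsum_le_tsum fun A => ?_
        rw [ENNReal.tsum_add, mul_add, mul_one]
        gcongr ?_ + ?_
        · rw [tsum_eq_sum (s := A) fun x hx => by simp [hx],
            Finset.sum_congr rfl (g := fun _ => π (clusterEq f F b A)) fun x hx => by simp [hx]]
          simp [mul_comm]
        · rw [Summable.tsum_finsetSum fun _ _ => ENNReal.summable]
          simp_rw [Summable.tsum_finsetSum fun _ _ => ENNReal.summable, ENNReal.tsum_mul_left]
          calc _ ≤ ∑ a ∈ A, ∑ d : ι × Bool, π (clusterEq f F b A) * (1 - t) * s := by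
                gcongr
                exact le_iSup (fun c => ∑' x, π {ξ | Conn f (restr F (upper ξ)) c x}) _
            _ ≤ _ := by
                simp only [Finset.sum_const, Finset.card_univ, Fintype.card_prod,
                  Fintype.card_bool, nsmul_eq_mul, Nat.cast_mul, Nat.cast_ofNat]
                apply le_of_eq
                ring
    _ ≤ _ := by
        rw [ENNReal.tsum_mul_right]
        gcongr

/-- If the expected cluster size is finite at some parameter, it remains finite after opening
additional edges with small probability. -/
lemma chi_ne_top_of_mul_lt_one [Countable G] [Fintype ι] {f : ι → G} {r t : ℝ≥0∞}
    {ν ν' ν'' : Measure (Config (G × ι))} (hν : IsBern (fun _ => r) ν)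
    (hν' : IsBern (fun _ => t) ν') (hν'' : IsBern (fun _ => r * t) ν'') (hfin : chi f ν ≠ ∞)
    (hlt : chi f ν * (2 * Fintype.card ι * (1 - t)) < 1) : chi f ν'' ≠ ∞ := by
  classical
  have hπ := hν.sum hν'
  set π := (ν.prod ν').map fun ω => (Sum.elim ω.1 ω.2 : Config (G × ι ⊕ G × ι))
  have := hπ.isProbabilityMeasure
  set k := chi f ν * (2 * Fintype.card ι * (1 - t))
  have h1k : 1 - k ≠ 0 := (tsub_pos_of_lt hlt).ne'
  have hbound (F : Finset (G × ι)) (b : G) :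
      ∑' x, π {ξ | Conn f (restr F (upper ξ)) b x} ≤ chi f ν / (1 - k) := by
    set s := ⨆ c, ∑' x, π {ξ | Conn f (restr F (upper ξ)) c x} with hs
    have hs_ne_top : s ≠ ∞ := by
      refine ne_top_of_le_ne_top (b := ((2 * F.card + 1 : ℕ) : ℝ≥0∞)) (natCast_ne_top _)
        (iSup_le fun c => ?_)
      obtain ⟨K, hK, hKc⟩ := exists_finset_conn_restr f F c
      rw [tsum_eq_sum (s := K) fun x hx => by
        rw [show {ξ | Conn f (restr F (upper ξ)) c x} = ∅ from
          Set.eq_empty_of_forall_notMem fun ξ hξ => hx (hKc _ _ hξ)]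
        simp]
      calc _ ≤ ∑ x ∈ K, 1 := Finset.sum_le_sum fun _ _ => prob_le_one
        _ ≤ _ := by simpa using mod_cast hK
    have hle : s ≤ chi f ν + k * s := by
      refine iSup_le fun c => (tsum_conn_upper_le hν hπ F c).trans (le_of_eq ?_)
      simp only [k]
      ring
    refine (le_iSup (fun c => ∑' x, π {ξ | Conn f (restr F (upper ξ)) c x}) b).trans ?_
    rw [ENNReal.le_div_iff_mul_le (.inl h1k) (.inl (by simp)),
      ENNReal.mul_sub fun _ _ => hs_ne_top, mul_one, mul_comm]
    exact tsub_le_iff_right.2 hle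
  have heq : ν'' = π.map upper := hν''.ext hπ.sup
  refine ne_top_of_le_ne_top (b := chi f ν / (1 - k))
    (ENNReal.div_ne_top hfin h1k) ?_
  rw [chi_eq_tsum]
  rw [ENNReal.tsum_eq_iSup_sum]
  refine iSup_le fun K => ?_
  simp_rw [measure_conn_eq_iSup]
  rw [ENNReal.finsetSum_iSup_of_monotone]
  · refine iSup_le fun F => le_trans ?_ (hbound F 1)
    refine le_trans (Finset.sum_le_sum fun x _ => le_of_eq ?_) (ENNReal.sum_le_tsum K)
    have hm : MeasurableSet {ω | Conn f (restr F ω) 1 x} :=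
      (measurableSet_conn f 1 x).preimage (measurable_restr _)
    rw [heq, Measure.map_apply measurable_upper hm]
    rfl
  · intro x F F' hF
    refine measure_mono fun ω => Conn.mono fun e he => ?_
    rw [restr_eq_true] at he ⊢
    exact ⟨he.1, hF he.2⟩

end Susceptibility

end Perc

namespace Perc

section FreeProduct

variable {Γ A B ι κ J : Type*} [Group Γ] [Group A] [Group B]

/-- `α : A →* Γ` and `β : B →* Γ` exhibit `Γ` as containing the free product of `A` and `B`, where
`LA` and `LB` are the sets of elements whose normal form begins with a syllable in `A`,
respectively `B`; the generators `F` of `Γ` are the generators `f` of `A`, labelled by `jA`,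
together with the generators `g` of `B`, labelled by `jB`. -/
structure IsFreeProd (α : A →* Γ) (β : B →* Γ) (f : ι → A) (g : κ → B) (jA : ι → J) (jB : κ → J)
    (F : J → Γ) (LA LB : Set Γ) : Prop where
  gen_left : ∀ i, F (jA i) = α (f i)
  gen_right : ∀ k, F (jB k) = β (g k)
  injective_left : Function.Injective jA
  injective_right : Function.Injective jB
  cover : ∀ j, j ∈ Set.range jA ∨ j ∈ Set.range jB
  disjoint_gen : ∀ j, j ∈ Set.range jA → j ∉ Set.range jB
  one_left : (1 : Γ) ∉ LA
  one_right : (1 : Γ) ∉ LB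
  disjoint : ∀ x ∈ LA, x ∉ LB
  mul_left : ∀ a, a ≠ 1 → ∀ y ∉ LA, α a * y ∈ LA
  mul_right : ∀ b, b ≠ 1 → ∀ y ∉ LB, β b * y ∈ LB

lemma IsFreeProd.symm {α : A →* Γ} {β : B →* Γ} {f : ι → A} {g : κ → B} {jA : ι → J} {jB : κ → J}
    {F : J → Γ} {LA LB : Set Γ} (h : IsFreeProd α β f g jA jB F LA LB) :
    IsFreeProd β α g f jB jA F LB LA where
  gen_left := h.gen_right
  gen_right := h.gen_left
  injective_left := h.injective_right
  injective_right := h.injective_left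
  cover j := (h.cover j).symm
  disjoint_gen j hB hA := h.disjoint_gen j hA hB
  one_left := h.one_right
  one_right := h.one_left
  disjoint x hB hA := h.disjoint x hA hB
  mul_left := h.mul_right
  mul_right := h.mul_left

/-- The event that the elements `1` and `a` of `A` are connected inside the copy of the Cayley graph
of `A` containing the identity of `Γ`. -/
def connIn (α : A →* Γ) (f : ι → A) (jA : ι → J) (a : A) : Set (Config (Γ × J)) :=
  {ω | Conn f (fun e => ω (α e.1, jA e.2)) 1 a}

/-- The edges of the branch at the identity consisting of the copies of Cayley graphs that are
reached by starting with a syllable in `A`. -/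
def cone (jA : ι → J) (jB : κ → J) (LA LB : Set Γ) : Set (Γ × J) :=
  {e | (e.2 ∈ Set.range jA ∧ e.1 ∉ LB) ∨ (e.2 ∈ Set.range jB ∧ e.1 ∈ LA)}

lemma measurableSet_connIn [Countable A] [Countable ι] (α : A →* Γ) (f : ι → A) (jA : ι → J)
    (a : A) : MeasurableSet (connIn α f jA a) :=
  (measurableSet_conn f 1 a).preimage (measurable_pullback fun e : A × ι => (α e.1, jA e.2))

lemma dep_connIn (α : A →* Γ) (f : ι → A) (jA : ι → J) (a : A) :
    Dep {e | ∃ x i, e = (α x, jA i)} (connIn α f jA a) := by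
  intro ω ω' h hω
  have : (fun e : A × ι => ω' (α e.1, jA e.2)) = fun e => ω (α e.1, jA e.2) :=
    funext fun e => (h _ ⟨_, _, rfl⟩).symm
  change Conn f _ 1 a
  rw [this]
  exact hω

lemma dep_shift {T : Set (Γ × J)} {S : Set (Config (Γ × J))} (hS : Dep T S) (z : Γ) :
    Dep {e | ∃ e' ∈ T, e = (z * e'.1, e'.2)} (shift z ⁻¹' S) := fun _ _ h hω =>
  hS _ _ (fun e he => h _ ⟨e, he, rfl⟩) hω

namespace IsFreeProd

variable {α : A →* Γ} {β : B →* Γ} {f : ι → A} {g : κ → B} {jA : ι → J} {jB : κ → J}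
    {F : J → Γ} {LA LB : Set Γ}

lemma not_mem_left_of_mem_cone (h : IsFreeProd α β f g jA jB F LA LB) {e : Γ × J}
    (he : e ∈ cone jB jA LB LA) : e.1 ∉ LA :=
  he.elim (fun h => h.2) fun h' h'' => h.disjoint _ h'' h'.2

lemma apply_not_mem_right (h : IsFreeProd α β f g jA jB F LA LB) (x : A) : α x ∉ LB := by
  by_cases hx : x = 1
  · rw [hx, map_one]; exact h.one_right
  · have := h.mul_left x hx 1 h.one_left
    rw [mul_one] at this
    exact h.disjoint _ this

lemma injective (h : IsFreeProd α β f g jA jB F LA LB) : Function.Injective α := by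
  rw [injective_iff_map_eq_one]
  intro a ha
  by_contra hne
  have := h.mul_left a hne 1 h.one_left
  rw [ha, mul_one] at this
  exact h.one_left this

lemma measure_connIn [Countable A] [Countable ι] (h : IsFreeProd α β f g jA jB F LA LB) {r : ℝ≥0∞}
    {ν : Measure (Config (Γ × J))} {νA : Measure (Config (A × ι))} (hν : IsBern (fun _ => r) ν)
    (hA : IsBern (fun _ => r) νA) (a : A) : ν (connIn α f jA a) = νA {ω | Conn f ω 1 a} := by
  have hinj : Function.Injective fun e : A × ι => (α e.1, jA e.2) := by
    rintro ⟨x, i⟩ ⟨y, k⟩ hxy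
    simp only [Prod.mk.injEq] at hxy
    rw [h.injective hxy.1, h.injective_left hxy.2]
  rw [hA.ext (hν.pullback hinj), Measure.map_apply (measurable_pullback _)
    (measurableSet_conn f 1 a)]
  rfl

lemma disjoint_connIn_shift (h : IsFreeProd α β f g jA jB F LA LB) (a : A) (e : Γ × J)
    (he : ∃ x i, e = (α x, jA i)) :
    e ∉ {e | ∃ e' ∈ cone jB jA LB LA, e = (α a * e'.1, e'.2)} := by
  rintro ⟨⟨y, j⟩, hy, rfl⟩
  obtain ⟨x, i, hxi⟩ := he
  simp only [Prod.mk.injEq] at hxi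
  obtain ⟨hx, rfl⟩ := hxi
  have hyB : y ∈ LB :=
    hy.elim (fun hy => absurd hy.1 (h.disjoint_gen _ ⟨i, rfl⟩)) fun hy => hy.2
  refine h.apply_not_mem_right (a⁻¹ * x) ?_
  rwa [map_mul, ← hx, map_inv, inv_mul_cancel_left]

lemma disjoint_shift_shift (h : IsFreeProd α β f g jA jB F LA LB) {a a' : A} (ha : a ≠ a')
    (e : Γ × J) (he : ∃ e' ∈ cone jB jA LB LA, e = (α a * e'.1, e'.2)) :
    e ∉ {e | ∃ e' ∈ cone jB jA LB LA, e = (α a' * e'.1, e'.2)} := by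
  rintro ⟨e', he', rfl⟩
  obtain ⟨e'', he'', heq⟩ := he
  simp only [Prod.mk.injEq] at heq
  refine h.not_mem_left_of_mem_cone he'' ?_
  have : e''.1 = α (a⁻¹ * a') * e'.1 := by
    rw [map_mul, map_inv, mul_assoc, heq.1, inv_mul_cancel_left]
  rw [this]
  exact h.mul_left _ (fun h1 => ha (inv_mul_eq_one.1 h1)) _ (h.not_mem_left_of_mem_cone he')

lemma dep_connIn_inter_shift (h : IsFreeProd α β f g jA jB F LA LB) {a : A} (ha : a ≠ 1)
    {S : Set (Config (Γ × J))} (hS : Dep (cone jB jA LB LA) S) :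
    Dep (cone jA jB LA LB) (connIn α f jA a ∩ shift (α a) ⁻¹' S) := by
  intro ω ω' hω h'
  refine ⟨dep_connIn α f jA a ω ω' ?_ h'.1, dep_shift hS _ ω ω' ?_ h'.2⟩
  · rintro _ ⟨x, i, rfl⟩
    exact hω _ (.inl ⟨⟨i, rfl⟩, h.apply_not_mem_right x⟩)
  · rintro _ ⟨e, he, rfl⟩
    have h1 := h.mul_left a ha _ (h.not_mem_left_of_mem_cone he)
    exact hω _ ((h.cover e.2).imp (fun h2 => ⟨h2, h.disjoint _ h1⟩) fun h2 => ⟨h2, h1⟩)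

lemma measure_connIn_inter_shift [Countable A] [Countable ι] (h : IsFreeProd α β f g jA jB F LA LB)
    {r : ℝ≥0∞} {ν : Measure (Config (Γ × J))} (hν : IsBern (fun _ => r) ν) (a : A)
    {S : Set (Config (Γ × J))} (hm : MeasurableSet S) (hS : Dep (cone jB jA LB LA) S) :
    ν (connIn α f jA a ∩ shift (α a) ⁻¹' S) = ν (connIn α f jA a) * ν S := by
  rw [hν.inter (measurableSet_connIn α f jA a) (hm.preimage (measurable_shift _))
    (dep_connIn α f jA a) (dep_shift hS _) (h.disjoint_connIn_shift a),
    ← Measure.map_apply (measurable_shift _) hm, hν.map_shift]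

lemma measure_shift_inter_shift (h : IsFreeProd α β f g jA jB F LA LB)
    {r : ℝ≥0∞} {ν : Measure (Config (Γ × J))} (hν : IsBern (fun _ => r) ν) {a a' : A} (ha : a ≠ a')
    {S : Set (Config (Γ × J))} (hm : MeasurableSet S) (hS : Dep (cone jB jA LB LA) S) :
    ν (shift (α a) ⁻¹' S ∩ shift (α a') ⁻¹' S) = ν S ^ 2 := by
  rw [hν.inter (hm.preimage (measurable_shift _)) (hm.preimage (measurable_shift _))
    (dep_shift hS _) (dep_shift hS _) (h.disjoint_shift_shift ha),
    ← Measure.map_apply (measurable_shift _) hm, ← Measure.map_apply (measurable_shift _) hm,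
    hν.map_shift, hν.map_shift, sq]

lemma conn_of_mem_connIn (h : IsFreeProd α β f g jA jB F LA LB) {ω : Config (Γ × J)} {a : A}
    (hω : ω ∈ connIn α f jA a) : Conn F ω 1 (α a) := by
  have := Conn.map (f := F) (ω := ω) (φ := α) (j := jA)
    (fun a k => by rw [map_mul, h.gen_left]) (fun _ _ => id) hω
  rwa [map_one] at this

end IsFreeProd

/-- Prepend a syllable in `A` to the elements of `V`. -/
def extend (α : A →* Γ) (f : ι → A) (jA : ι → J) (V : Config (Γ × J) → Set Γ)
    (ω : Config (Γ × J)) : Set Γ :=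
  {z | ∃ a : {a : A // a ≠ 1}, ω ∈ connIn α f jA a ∧ (α a)⁻¹ * z ∈ V (shift (α a) ω)}

/-- The elements of the cluster of the identity whose normal form has `n` syllables, the first one
in `A` (first component) or in `B` (second component). -/
def level (α : A →* Γ) (β : B →* Γ) (f : ι → A) (g : κ → B) (jA : ι → J) (jB : κ → J) :
    ℕ → (Config (Γ × J) → Set Γ) × (Config (Γ × J) → Set Γ)
  | 0 => (fun _ => {1}, fun _ => {1})
  | n + 1 => (extend α f jA (level α β f g jA jB n).2, extend β g jB (level α β f g jA jB n).1)

namespace IsFreeProd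

variable {α : A →* Γ} {β : B →* Γ} {f : ι → A} {g : κ → B} {jA : ι → J} {jB : κ → J}
    {F : J → Γ} {LA LB : Set Γ}

lemma setOf_mem_extend (V : Config (Γ × J) → Set Γ) (z : Γ) :
    {ω | z ∈ extend α f jA V ω} = ⋃ a : {a : A // a ≠ 1},
      connIn α f jA a ∩ shift (α a) ⁻¹' {ω | (α a)⁻¹ * z ∈ V ω} := by
  ext ω
  simp [extend]

lemma extend_measurable_dep [Countable A] [Countable ι] (h : IsFreeProd α β f g jA jB F LA LB)
    {V : Config (Γ × J) → Set Γ}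
    (hV : ∀ z, MeasurableSet {ω | z ∈ V ω} ∧ Dep (cone jB jA LB LA) {ω | z ∈ V ω}) (z : Γ) :
    MeasurableSet {ω | z ∈ extend α f jA V ω} ∧
      Dep (cone jA jB LA LB) {ω | z ∈ extend α f jA V ω} := by
  rw [setOf_mem_extend]
  refine ⟨MeasurableSet.iUnion fun a => (measurableSet_connIn α f jA a).inter
    ((hV _).1.preimage (measurable_shift _)), fun ω ω' hω hmem => ?_⟩
  obtain ⟨a, ha⟩ := Set.mem_iUnion.1 hmem
  exact Set.mem_iUnion.2 ⟨a, h.dep_connIn_inter_shift a.2 (hV _).2 ω ω' hω ha⟩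

lemma tsum_extend_le [Countable A] [Countable ι] (h : IsFreeProd α β f g jA jB F LA LB)
    {r : ℝ≥0∞} {ν : Measure (Config (Γ × J))} {νA : Measure (Config (A × ι))}
    (hν : IsBern (fun _ => r) ν) (hA : IsBern (fun _ => r) νA) {V : Config (Γ × J) → Set Γ}
    (hV : ∀ z, MeasurableSet {ω | z ∈ V ω} ∧ Dep (cone jB jA LB LA) {ω | z ∈ V ω}) :
    ∑' z, ν {ω | z ∈ extend α f jA V ω} ≤ chi' f νA * ∑' z, ν {ω | z ∈ V ω} := by
  calc ∑' z, ν {ω | z ∈ extend α f jA V ω}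
      ≤ ∑' z, ∑' a : {a : A // a ≠ 1}, νA {ω | Conn f ω 1 a} * ν {ω | (α a)⁻¹ * z ∈ V ω} := by
        refine ENNReal.tsum_le_tsum fun z => ?_
        rw [setOf_mem_extend]
        refine (measure_iUnion_le _).trans (ENNReal.tsum_le_tsum fun a => le_of_eq ?_)
        rw [h.measure_connIn_inter_shift hν a (hV _).1 (hV _).2, h.measure_connIn hν hA]
    _ = _ := by
        rw [ENNReal.tsum_comm, chi', ← ENNReal.tsum_mul_right]
        refine tsum_congr fun a => ?_
        rw [ENNReal.tsum_mul_left]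
        congr 1
        exact (Equiv.mulLeft (α a)⁻¹).tsum_eq fun z => ν {ω | z ∈ V ω}

lemma level_measurable_dep [Countable A] [Countable B] [Countable ι] [Countable κ]
    (h : IsFreeProd α β f g jA jB F LA LB) (n : ℕ) :
    (∀ z, MeasurableSet {ω | z ∈ (level α β f g jA jB n).1 ω} ∧
      Dep (cone jA jB LA LB) {ω | z ∈ (level α β f g jA jB n).1 ω}) ∧
    (∀ z, MeasurableSet {ω | z ∈ (level α β f g jA jB n).2 ω} ∧
      Dep (cone jB jA LB LA) {ω | z ∈ (level α β f g jA jB n).2 ω}) := by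
  induction n with
  | zero => exact ⟨fun z => ⟨MeasurableSet.const _, fun _ _ _ => id⟩,
      fun z => ⟨MeasurableSet.const _, fun _ _ _ => id⟩⟩
  | succ n ih => exact ⟨h.extend_measurable_dep ih.2, h.symm.extend_measurable_dep ih.1⟩

lemma step_one (h : IsFreeProd α β f g jA jB F LA LB) {ω : Config (Γ × J)} {z : Γ}
    (hs : Step F ω 1 z) :
    (∃ a, ω ∈ connIn α f jA a ∧ z = α a) ∨ (∃ b, ω ∈ connIn β g jB b ∧ z = β b) := by
  obtain ⟨j, hj⟩ := hs
  have hj' : (ω (1, j) = true ∧ z = F j) ∨ (ω (z, j) = true ∧ z = (F j)⁻¹) := by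
    rwa [one_mul, eq_comm (a := (1 : Γ)), mul_eq_one_iff_eq_inv] at hj
  rcases h.cover j with ⟨i, rfl⟩ | ⟨i, rfl⟩
  · rw [h.gen_left, ← map_inv] at hj'
    rcases hj' with ⟨h1, rfl⟩ | ⟨h1, rfl⟩
    · exact .inl ⟨_, .single ⟨i, .inl ⟨by simpa using h1, by simp⟩⟩, rfl⟩
    · exact .inl ⟨_, .single ⟨i, .inr ⟨by simpa using h1, by simp⟩⟩, rfl⟩
  · rw [h.gen_right, ← map_inv] at hj'
    rcases hj' with ⟨h1, rfl⟩ | ⟨h1, rfl⟩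
    · exact .inr ⟨_, .single ⟨i, .inl ⟨by simpa using h1, by simp⟩⟩, rfl⟩
    · exact .inr ⟨_, .single ⟨i, .inr ⟨by simpa using h1, by simp⟩⟩, rfl⟩

lemma exists_mem_of_mem_connIn {WA WB : ℕ → Config (Γ × J) → Set Γ} (hA0 : ∀ ω, WA 0 ω = {1})
    (hB0 : ∀ ω, WB 0 ω = {1}) (hA : ∀ n, WA (n + 1) = extend α f jA (WB n)) {ω : Config (Γ × J)}
    {a : A} (ha : ω ∈ connIn α f jA a) : α a ∈ WA 0 ω ∨ α a ∈ WA 1 ω := by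
  by_cases h1 : a = 1
  · left; simp [hA0, h1]
  · right
    rw [hA]
    exact ⟨⟨a, h1⟩, ha, by simp [hB0]⟩

lemma exists_mem_of_step {WA WB : ℕ → Config (Γ × J) → Set Γ} (hA0 : ∀ ω, WA 0 ω = {1})
    (hB0 : ∀ ω, WB 0 ω = {1}) (hA : ∀ n, WA (n + 1) = extend α f jA (WB n)) {n : ℕ}
    (ih : ∀ ω y z, y ∈ WB n ω → Step F ω y z → (∃ k, z ∈ WB k ω) ∨ z ∈ WA 1 ω)
    (ω : Config (Γ × J)) (y z : Γ) (hy : y ∈ WA (n + 1) ω) (hs : Step F ω y z) :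
    (∃ k, z ∈ WA k ω) ∨ z ∈ WB 1 ω := by
  left
  rw [hA] at hy
  obtain ⟨a, ha, hya⟩ := hy
  have hs' : Step F (shift (α a) ω) ((α a)⁻¹ * y) ((α a)⁻¹ * z) := by
    obtain ⟨j, ⟨hj, rfl⟩ | ⟨hj, rfl⟩⟩ := hs
    · exact ⟨j, .inl ⟨by simpa [shift] using hj, by simp [mul_assoc]⟩⟩
    · exact ⟨j, .inr ⟨by simpa [shift] using hj, by simp [mul_assoc]⟩⟩
  rcases ih _ _ _ hya hs' with ⟨k, hk⟩ | h1
  · exact ⟨k + 1, by rw [hA]; exact ⟨a, ha, hk⟩⟩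
  · rw [hA] at h1
    obtain ⟨a', ha', hz⟩ := h1
    rw [hB0, Set.mem_singleton_iff, inv_mul_eq_one, eq_inv_mul_iff_mul_eq, ← map_mul] at hz
    subst hz
    have hconn : ω ∈ connIn α f jA (a * a') := by
      refine Relation.ReflTransGen.trans ha ?_
      have := Conn.map (f := f) (ω := fun e => ω (α e.1, jA e.2)) (φ := (a.1 * ·)) (j := id)
        (fun x k => by simp [mul_assoc]) (fun x k hk => by simpa [shift] using hk) ha'
      simp only [mul_one] at this
      exact this
    exact (exists_mem_of_mem_connIn hA0 hB0 hA hconn).elim (fun h => ⟨0, h⟩) fun h => ⟨1, h⟩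

lemma exists_mem_level (h : IsFreeProd α β f g jA jB F LA LB) {ω : Config (Γ × J)} {z : Γ}
    (hz : Conn F ω 1 z) :
    ∃ n, z ∈ (level α β f g jA jB n).1 ω ∨ z ∈ (level α β f g jA jB n).2 ω := by
  set WA := fun n => (level α β f g jA jB n).1
  set WB := fun n => (level α β f g jA jB n).2
  have hA0 : ∀ ω, WA 0 ω = {1} := fun _ => rfl
  have hB0 : ∀ ω, WB 0 ω = {1} := fun _ => rfl
  have hA : ∀ n, WA (n + 1) = extend α f jA (WB n) := fun _ => rfl
  have hB : ∀ n, WB (n + 1) = extend β g jB (WA n) := fun _ => rfl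
  have hstart (ω z) (hs : Step F ω 1 z) :
      ((z ∈ WA 0 ω ∨ z ∈ WA 1 ω) ∨ (z ∈ WB 0 ω ∨ z ∈ WB 1 ω)) := by
    rcases h.step_one hs with ⟨a, ha, rfl⟩ | ⟨b, hb, rfl⟩
    · exact .inl (exists_mem_of_mem_connIn hA0 hB0 hA ha)
    · exact .inr (exists_mem_of_mem_connIn hB0 hA0 hB hb)
  have key (n : ℕ) :
      (∀ ω y z, y ∈ WA n ω → Step F ω y z → (∃ k, z ∈ WA k ω) ∨ z ∈ WB 1 ω) ∧
      (∀ ω y z, y ∈ WB n ω → Step F ω y z → (∃ k, z ∈ WB k ω) ∨ z ∈ WA 1 ω) := by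
    induction n with
    | zero =>
      refine ⟨fun ω y z hy hs => ?_, fun ω y z hy hs => ?_⟩ <;>
      · obtain rfl : y = 1 := hy
        rcases hstart ω z hs with (h1 | h1) | (h1 | h1)
        all_goals first
          | exact .inr h1
          | exact .inl ⟨0, h1⟩
          | exact .inl ⟨1, h1⟩
    | succ n ih => exact ⟨exists_mem_of_step hA0 hB0 hA ih.2, exists_mem_of_step hB0 hA0 hB ih.1⟩
  change ∃ n, z ∈ WA n ω ∨ z ∈ WB n ω
  induction hz with
  | refl => exact ⟨0, .inl rfl⟩
  | tail _ hs ih =>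
    obtain ⟨n, hn | hn⟩ := ih
    · rcases (key n).1 _ _ _ hn hs with ⟨k, hk⟩ | h1
      · exact ⟨k, .inl hk⟩
      · exact ⟨1, .inr h1⟩
    · rcases (key n).2 _ _ _ hn hs with ⟨k, hk⟩ | h1
      · exact ⟨k, .inr hk⟩
      · exact ⟨1, .inl h1⟩

end IsFreeProd

lemma tsum_ne_top_of_two_step {u : ℕ → ℝ≥0∞} {m : ℝ≥0∞} (hm : m < 1) (h0 : u 0 ≠ ∞) (h1 : u 1 ≠ ∞)
    (h : ∀ n, u (n + 2) ≤ m * u n) : ∑' n, u n ≠ ∞ := by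
  have hgeom : (∑' n, m ^ n) ≠ ∞ := by
    rw [ENNReal.tsum_geometric]
    exact ENNReal.inv_ne_top.2 (tsub_pos_of_lt hm).ne'
  have heven (k : ℕ) : u (2 * k) ≤ m ^ k * u 0 := by
    induction k with
    | zero => simp
    | succ k ih =>
      calc u (2 * (k + 1)) ≤ m * u (2 * k) := h (2 * k)
        _ ≤ m * (m ^ k * u 0) := by gcongr
        _ = _ := by ring
  have hodd (k : ℕ) : u (2 * k + 1) ≤ m ^ k * u 1 := by
    induction k with
    | zero => simp
    | succ k ih =>
      calc u (2 * (k + 1) + 1) ≤ m * u (2 * k + 1) := h (2 * k + 1)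
        _ ≤ m * (m ^ k * u 1) := by gcongr
        _ = _ := by ring
  rw [← tsum_even_add_odd ENNReal.summable ENNReal.summable]
  refine ENNReal.add_ne_top.2 ⟨?_, ?_⟩
  · refine ne_top_of_le_ne_top ?_ (ENNReal.tsum_le_tsum heven)
    rw [ENNReal.tsum_mul_right]
    exact ENNReal.mul_ne_top hgeom h0
  · refine ne_top_of_le_ne_top ?_ (ENNReal.tsum_le_tsum hodd)
    rw [ENNReal.tsum_mul_right]
    exact ENNReal.mul_ne_top hgeom h1

/-- The expected cluster size in a free product is finite if the alternating branching process of
clusters in the factors is subcritical. -/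
lemma IsFreeProd.chi_ne_top [Countable Γ] [Countable A] [Countable B] [Countable ι] [Countable κ]
    [Countable J] {α : A →* Γ} {β : B →* Γ} {f : ι → A} {g : κ → B} {jA : ι → J} {jB : κ → J}
    {F : J → Γ} {LA LB : Set Γ} (h : IsFreeProd α β f g jA jB F LA LB) {r : ℝ≥0∞}
    {ν : Measure (Config (Γ × J))} {νA : Measure (Config (A × ι))} {νB : Measure (Config (B × κ))}
    (hν : IsBern (fun _ => r) ν) (hA : IsBern (fun _ => r) νA) (hB : IsBern (fun _ => r) νB)
    (hAtop : chi' f νA ≠ ∞) (hBtop : chi' g νB ≠ ∞) (hlt : chi' f νA * chi' g νB < 1) :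
    chi F ν ≠ ∞ := by
  have := hν.isProbabilityMeasure
  let u : ℕ → ℝ≥0∞ := fun n => ∑' z, ν {ω | z ∈ (level α β f g jA jB n).1 ω}
  let v : ℕ → ℝ≥0∞ := fun n => ∑' z, ν {ω | z ∈ (level α β f g jA jB n).2 ω}
  have hu (n) : u (n + 1) ≤ chi' f νA * v n :=
    h.tsum_extend_le hν hA (h.level_measurable_dep n).2
  have hv (n) : v (n + 1) ≤ chi' g νB * u n :=
    h.symm.tsum_extend_le hν hB (h.level_measurable_dep n).1
  have hone : ∑' z : Γ, ν {_ω | z ∈ ({1} : Set Γ)} = 1 := by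
    rw [tsum_eq_single 1 fun z hz => by simp [hz]]
    simp
  have hu0 : u 0 = 1 := hone
  have hv0 : v 0 = 1 := hone
  have hsu : ∑' n, u n ≠ ∞ := by
    refine tsum_ne_top_of_two_step hlt (by simp [hu0])
      (ne_top_of_le_ne_top (by simpa [hv0] using hAtop) (hu 0)) fun n => ?_
    rw [mul_assoc]
    exact (hu (n + 1)).trans (by gcongr; exact hv n)
  have hsv : ∑' n, v n ≠ ∞ := by
    refine tsum_ne_top_of_two_step hlt (by simp [hv0])
      (ne_top_of_le_ne_top (by simpa [hu0] using hBtop) (hv 0)) fun n => ?_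
    rw [mul_comm (chi' f νA), mul_assoc]
    exact (hv (n + 1)).trans (by gcongr; exact hu n)
  refine ne_top_of_le_ne_top (ENNReal.add_ne_top.2 ⟨hsu, hsv⟩) ?_
  rw [chi_eq_tsum, ENNReal.tsum_comm, ENNReal.tsum_comm (f := fun n z =>
    ν {ω | z ∈ (level α β f g jA jB n).2 ω}), ← ENNReal.tsum_add]
  refine ENNReal.tsum_le_tsum fun z => ?_
  have hsub : {ω | Conn F ω 1 z} ⊆ (⋃ n, {ω | z ∈ (level α β f g jA jB n).1 ω}) ∪
      ⋃ n, {ω | z ∈ (level α β f g jA jB n).2 ω} := fun ω hω => by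
    obtain ⟨n, hn | hn⟩ := h.exists_mem_level hω
    · exact .inl (Set.mem_iUnion.2 ⟨n, hn⟩)
    · exact .inr (Set.mem_iUnion.2 ⟨n, hn⟩)
  exact (measure_mono hsub).trans ((measure_union_le _ _).trans
    (add_le_add (measure_iUnion_le _) (measure_iUnion_le _)))

end FreeProduct

end Perc

namespace Perc

section Supercritical

lemma sum_measure_le_measure_biUnion_add {Ω X : Type*} [MeasurableSpace Ω] {ν : Measure Ω}
    {E : X → Set Ω} (hE : ∀ a, MeasurableSet (E a)) {c : ℝ≥0∞}
    (hc : ∀ a a', a ≠ a' → ν (E a ∩ E a') ≤ c) (K : Finset X) :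
    ∑ a ∈ K, ν (E a) ≤ ν (⋃ a ∈ K, E a) + (K.card : ℝ≥0∞) ^ 2 * c := by
  classical
  induction K using Finset.induction_on with
  | empty => simp
  | insert a K ha ih =>
    have hU : MeasurableSet (⋃ a ∈ K, E a) := Finset.measurableSet_biUnion _ fun a _ => hE a
    have hint : ν (E a ∩ ⋃ a ∈ K, E a) ≤ K.card * c := by
      rw [Set.inter_iUnion₂]
      refine (measure_biUnion_finset_le _ _).trans ?_
      refine (Finset.sum_le_card_nsmul _ _ c fun b hb => hc a b ?_).trans (by simp)
      rintro rfl
      exact ha hb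
    rw [Finset.sum_insert ha, Finset.set_biUnion_insert, Finset.card_insert_of_notMem ha]
    calc ν (E a) + ∑ a ∈ K, ν (E a)
        ≤ ν (E a) + (ν (⋃ a ∈ K, E a) + (K.card : ℝ≥0∞) ^ 2 * c) := by gcongr
      _ = ν (E a ∪ ⋃ a ∈ K, E a) + ν (E a ∩ ⋃ a ∈ K, E a) + (K.card : ℝ≥0∞) ^ 2 * c := by
        rw [measure_union_add_inter _ hU, add_assoc]
      _ ≤ ν (E a ∪ ⋃ a ∈ K, E a) + K.card * c + (K.card : ℝ≥0∞) ^ 2 * c := by gcongr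
      _ ≤ ν (E a ∪ ⋃ a ∈ K, E a) + (K.card * c + (K.card : ℝ≥0∞) ^ 2 * c + (K.card + 1) * c) := by
        rw [add_assoc]
        exact add_le_add_right le_self_add _
      _ = _ := by
        push_cast
        ring

variable {Γ A B ι κ J : Type*} [Group Γ] [Group A] [Group B]

/-- The event that for some `a ∈ K` the identity is connected to `α a` in the copy of the Cayley
graph of `A`, and the event `S` happens at `α a`. -/
def branch (α : A →* Γ) (f : ι → A) (jA : ι → J) (K : Finset A) (S : Set (Config (Γ × J))) :
    Set (Config (Γ × J)) :=
  ⋃ a ∈ K, connIn α f jA a ∩ shift (α a) ⁻¹' S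

lemma branch_mono (α : A →* Γ) (f : ι → A) (jA : ι → J) (K : Finset A) :
    Monotone (branch α f jA K) := fun _ _ h =>
  Set.iUnion₂_mono fun _ _ => Set.inter_subset_inter_right _ (Set.preimage_mono h)

lemma measurableSet_branch [Countable A] [Countable ι] (α : A →* Γ) (f : ι → A) (jA : ι → J)
    (K : Finset A) {S : Set (Config (Γ × J))} (hm : MeasurableSet S) :
    MeasurableSet (branch α f jA K S) :=
  Finset.measurableSet_biUnion _ fun a _ =>
    (measurableSet_connIn α f jA a).inter (hm.preimage (measurable_shift _))

namespace IsFreeProd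

variable {α : A →* Γ} {β : B →* Γ} {f : ι → A} {g : κ → B} {jA : ι → J} {jB : κ → J}
    {F : J → Γ} {LA LB : Set Γ}

lemma dep_branch (h : IsFreeProd α β f g jA jB F LA LB) {K : Finset A} (hK : 1 ∉ K)
    {S : Set (Config (Γ × J))} (hS : Dep (cone jB jA LB LA) S) :
    Dep (cone jA jB LA LB) (branch α f jA K S) := fun ω ω' hω hmem => by
  obtain ⟨a, ha, h'⟩ := Set.mem_iUnion₂.1 hmem
  exact Set.mem_iUnion₂.2
    ⟨a, ha, h.dep_connIn_inter_shift (ne_of_mem_of_not_mem ha hK) hS ω ω' hω h'⟩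

section Measure

variable [Countable A] [Countable ι] {r : ℝ≥0∞} {ν : Measure (Config (Γ × J))}

lemma sum_measure_connIn_inter_shift (h : IsFreeProd α β f g jA jB F LA LB)
    (hν : IsBern (fun _ => r) ν) (K : Finset A) {S : Set (Config (Γ × J))} (hm : MeasurableSet S)
    (hS : Dep (cone jB jA LB LA) S) :
    ∑ a ∈ K, ν (connIn α f jA a ∩ shift (α a) ⁻¹' S) =
      (∑ a ∈ K, ν (connIn α f jA a)) * ν S := by
  rw [Finset.sum_mul]
  exact Finset.sum_congr rfl fun a _ => h.measure_connIn_inter_shift hν a hm hS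

lemma measure_branch_le (h : IsFreeProd α β f g jA jB F LA LB) (hν : IsBern (fun _ => r) ν)
    (K : Finset A) {S : Set (Config (Γ × J))} (hm : MeasurableSet S)
    (hS : Dep (cone jB jA LB LA) S) :
    ν (branch α f jA K S) ≤ (∑ a ∈ K, ν (connIn α f jA a)) * ν S :=
  (measure_biUnion_finset_le _ _).trans (h.sum_measure_connIn_inter_shift hν K hm hS).le

lemma le_measure_branch_add (h : IsFreeProd α β f g jA jB F LA LB) (hν : IsBern (fun _ => r) ν)
    (K : Finset A) {S : Set (Config (Γ × J))} (hm : MeasurableSet S)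
    (hS : Dep (cone jB jA LB LA) S) :
    (∑ a ∈ K, ν (connIn α f jA a)) * ν S ≤
      ν (branch α f jA K S) + (K.card : ℝ≥0∞) ^ 2 * ν S ^ 2 := by
  rw [← h.sum_measure_connIn_inter_shift hν K hm hS]
  refine sum_measure_le_measure_biUnion_add (fun a => (measurableSet_connIn α f jA a).inter
    (hm.preimage (measurable_shift _))) (fun a a' ha => ?_) K
  rw [← h.measure_shift_inter_shift hν ha hm hS]
  exact measure_mono (Set.inter_subset_inter Set.inter_subset_right Set.inter_subset_right)

lemma measure_branch_ne_zero (h : IsFreeProd α β f g jA jB F LA LB) (hν : IsBern (fun _ => r) ν)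
    {K : Finset A} {S : Set (Config (Γ × J))} (hm : MeasurableSet S)
    (hS : Dep (cone jB jA LB LA) S) (hK : ∑ a ∈ K, ν (connIn α f jA a) ≠ 0) (h0 : ν S ≠ 0) :
    ν (branch α f jA K S) ≠ 0 := by
  intro hz
  refine mul_ne_zero hK h0 ?_
  rw [← h.sum_measure_connIn_inter_shift hν K hm hS]
  exact Finset.sum_eq_zero fun a ha => measure_mono_null
    (Set.subset_biUnion_of_mem (u := fun a => connIn α f jA a ∩ shift (α a) ⁻¹' S) ha) hz

end Measure

lemma exists_finset_of_mem_branch (h : IsFreeProd α β f g jA jB F LA LB) {K : Finset A}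
    (hK : 1 ∉ K) {S : Set (Config (Γ × J))} {n : ℕ}
    (hS : ∀ ω ∈ S, ∃ T : Finset Γ, n ≤ T.card ∧ ∀ y ∈ T, y ∉ LA ∧ Conn F ω 1 y) :
    ∀ ω ∈ branch α f jA K S,
      ∃ T : Finset Γ, n + 1 ≤ T.card ∧ ∀ y ∈ T, y ∉ LB ∧ Conn F ω 1 y := by
  classical
  intro ω hω
  obtain ⟨a, ha, hconn, hshift⟩ := Set.mem_iUnion₂.1 hω
  obtain ⟨T, hcard, hT⟩ := hS _ hshift
  have hmem : ∀ y ∈ T, α a * y ∈ LA := fun y hy =>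
    h.mul_left a (ne_of_mem_of_not_mem ha hK) y (hT y hy).1
  refine ⟨insert 1 (T.image (α a * ·)), ?_, ?_⟩
  · rw [Finset.card_insert_of_notMem, Finset.card_image_of_injective _ (mul_right_injective _)]
    · omega
    · intro h1
      obtain ⟨y, hy, hy1⟩ := Finset.mem_image.1 h1
      have := hmem y hy
      rw [hy1] at this
      exact h.one_left this
  · intro z hz
    rcases Finset.mem_insert.1 hz with rfl | hz
    · exact ⟨h.one_right, .refl⟩
    · obtain ⟨y, hy, rfl⟩ := Finset.mem_image.1 hz
      refine ⟨h.disjoint _ (hmem y hy), (h.conn_of_mem_connIn hconn).trans ?_⟩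
      have := conn_shift.1 (hT y hy).2
      rwa [mul_one] at this

/-- If truncated expected numbers of neighbours in the alternating branching process of clusters in
the factors have a product larger than one, then the cluster of the identity in the free product is
infinite with positive probability. -/
lemma measure_infinite_ne_zero_of_finset [Countable A] [Countable B] [Countable ι] [Countable κ]
    (h : IsFreeProd α β f g jA jB F LA LB) {r : ℝ≥0∞}
    {ν : Measure (Config (Γ × J))} (hν : IsBern (fun _ => r) ν) {K : Finset A} {K' : Finset B}
    (hK : 1 ∉ K) (hK' : 1 ∉ K')
    (hlt : 1 < (∑ a ∈ K, ν (connIn α f jA a)) * ∑ b ∈ K', ν (connIn β g jB b)) :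
    ν {ω | (cluster F ω).Infinite} ≠ 0 := by
  have hprob := hν.isProbabilityMeasure
  set m := ∑ a ∈ K, ν (connIn α f jA a) with hm
  set m' := ∑ b ∈ K', ν (connIn β g jB b) with hm'
  have hm0 : m ≠ 0 := by rintro h0; simp [h0] at hlt
  have hm0' : m' ≠ 0 := by rintro h0; simp [h0] at hlt
  have hmt : m ≠ ∞ := ENNReal.sum_ne_top.2 fun _ _ => measure_ne_top _ _
  have hmt' : m' ≠ ∞ := ENNReal.sum_ne_top.2 fun _ _ => measure_ne_top _ _
  let X : ℕ → Set (Config (Γ × J)) := fun n =>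
    (fun S => branch α f jA K (branch β g jB K' S))^[n] Set.univ
  have hX (n) : X (n + 1) = branch α f jA K (branch β g jB K' (X n)) :=
    Function.iterate_succ_apply' _ _ _
  have hmeas (n) : MeasurableSet (X n) := by
    induction n with
    | zero => exact MeasurableSet.univ
    | succ n ih =>
      rw [hX]
      exact measurableSet_branch _ _ _ _ (measurableSet_branch _ _ _ _ ih)
  have hdep (n) : Dep (cone jA jB LA LB) (X n) := by
    induction n with
    | zero => exact fun _ _ _ => id
    | succ n ih =>
      rw [hX]
      exact h.dep_branch hK (h.symm.dep_branch hK' ih)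
  have hsucc (n) : X (n + 1) ⊆ X n := by
    induction n with
    | zero => exact Set.subset_univ _
    | succ n ih =>
      rw [hX (n + 1)]
      nth_rewrite 2 [hX n]
      exact branch_mono _ _ _ _ (branch_mono _ _ _ _ ih)
  have hanti : Antitone X := antitone_nat_of_succ_le hsucc
  have hpos (n) : ν (X n) ≠ 0 := by
    induction n with
    | zero => simp [X]
    | succ n ih =>
      rw [hX]
      exact h.measure_branch_ne_zero hν (measurableSet_branch _ _ _ _ (hmeas n))
        (h.symm.dep_branch hK' (hdep n)) hm0
        (h.symm.measure_branch_ne_zero hν (hmeas n) (hdep n) hm0' ih)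
  have hcard (n) : ∀ ω ∈ X n,
      ∃ T : Finset Γ, 2 * n ≤ T.card ∧ ∀ y ∈ T, y ∉ LB ∧ Conn F ω 1 y := by
    induction n with
    | zero => exact fun _ _ => ⟨∅, by simp, by simp⟩
    | succ n ih =>
      rw [hX]
      exact h.exists_finset_of_mem_branch hK (h.symm.exists_finset_of_mem_branch hK' ih)
  set C : ℝ≥0∞ := (K.card : ℝ≥0∞) ^ 2 * m' ^ 2 + m * (K'.card : ℝ≥0∞) ^ 2 with hC
  have hCt : C ≠ ∞ := by
    rw [hC]
    finiteness
  have hlow (n) : (m * m' - 1) / C ≤ ν (X n) := by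
    refine ENNReal.div_le_of_le_mul' (tsub_le_iff_left.2 ?_)
    have h1 := h.symm.le_measure_branch_add hν K' (hmeas n) (hdep n)
    have h2 := h.symm.measure_branch_le hν K' (hmeas n) (hdep n)
    have h3 := h.le_measure_branch_add hν K (measurableSet_branch β g jB K' (hmeas n))
      (h.symm.dep_branch hK' (hdep n))
    rw [← hX n] at h3
    set x := ν (X n) with hx
    set y := ν (branch β g jB K' (X n)) with hy
    refine (ENNReal.mul_le_mul_iff_left (hpos n) (measure_ne_top ν (X n))).1 ?_
    calc m * m' * x = m * (m' * x) := mul_assoc _ _ _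
      _ ≤ m * (y + (K'.card : ℝ≥0∞) ^ 2 * x ^ 2) := by gcongr
      _ = m * y + m * ((K'.card : ℝ≥0∞) ^ 2 * x ^ 2) := mul_add _ _ _
      _ ≤ (ν (X (n + 1)) + (K.card : ℝ≥0∞) ^ 2 * y ^ 2) + m * ((K'.card : ℝ≥0∞) ^ 2 * x ^ 2) := by
        gcongr
      _ ≤ (x + (K.card : ℝ≥0∞) ^ 2 * (m' * x) ^ 2) + m * ((K'.card : ℝ≥0∞) ^ 2 * x ^ 2) := by
        gcongr
        exact measure_mono (hsucc n)
      _ = (1 + C * x) * x := by rw [hC]; ring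
  have hinter : (m * m' - 1) / C ≤ ν (⋂ n, X n) := by
    rw [hanti.measure_iInter (fun n => (hmeas n).nullMeasurableSet) ⟨0, measure_ne_top _ _⟩]
    exact le_iInf hlow
  have hne : (m * m' - 1) / C ≠ 0 :=
    ENNReal.div_ne_zero.2 ⟨(tsub_pos_of_lt hlt).ne', hCt⟩
  refine fun hz => hne (le_antisymm (hinter.trans ?_) bot_le)
  rw [← hz]
  refine measure_mono fun ω hω hfin => ?_
  obtain ⟨T, hT, hT'⟩ := hcard (hfin.toFinset.card + 1) ω (Set.mem_iInter.1 hω _)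
  have := Finset.card_le_card (s := T) (t := hfin.toFinset) fun y hy =>
    hfin.mem_toFinset.2 (hT' y hy).2
  omega

lemma measure_infinite_ne_zero [Countable A] [Countable B] [Countable ι] [Countable κ]
    (h : IsFreeProd α β f g jA jB F LA LB) {r : ℝ≥0∞} {ν : Measure (Config (Γ × J))}
    {νA : Measure (Config (A × ι))} {νB : Measure (Config (B × κ))} (hν : IsBern (fun _ => r) ν)
    (hA : IsBern (fun _ => r) νA) (hB : IsBern (fun _ => r) νB) (hlt : 1 < chi' f νA * chi' g νB) :
    ν {ω | (cluster F ω).Infinite} ≠ 0 := by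
  classical
  simp_rw [chi', ENNReal.tsum_eq_iSup_sum, ENNReal.iSup_mul, ENNReal.mul_iSup, lt_iSup_iff] at hlt
  obtain ⟨K, K', hlt⟩ := hlt
  refine h.measure_infinite_ne_zero_of_finset hν (K := K.map ⟨_, Subtype.val_injective⟩)
    (K' := K'.map ⟨_, Subtype.val_injective⟩) (by simp) (by simp) ?_
  simp only [Finset.sum_map, Function.Embedding.coeFn_mk]
  simp_rw [h.measure_connIn hν hA, h.symm.measure_connIn hν hB]
  exact hlt

end IsFreeProd

lemma measure_infinite_eq_zero {G ι : Type*} [Group G] [Countable G] [Countable ι] {f : ι → G}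
    {ν : Measure (Config (G × ι))} (h : chi f ν ≠ ∞) : ν {ω | (cluster f ω).Infinite} = 0 := by
  have hmeas : Measurable fun ω => ((cluster f ω).encard : ℝ≥0∞) := by
    simp_rw [encard_cluster_eq_tsum]
    exact Measurable.tsum fun y => measurable_one.indicator (measurableSet_conn f 1 y)
  have := ae_lt_top hmeas h
  rw [ae_iff] at this
  refine measure_mono_null (fun ω hω => ?_) this
  simpa using hω

end Supercritical

end Perc

namespace Perc

section Coprod

universe u v

variable (G₁ : Type u) (G₂ : Type v) [Group G₁] [Group G₂]

/-- The two factors of a free product, as a family of groups indexed by `Bool`. -/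
def Factor : Bool → Type max u v
  | true => ULift.{v} G₁
  | false => ULift.{u} G₂

instance : ∀ b, Group (Factor G₁ G₂ b)
  | true => inferInstanceAs (Group (ULift.{v} G₁))
  | false => inferInstanceAs (Group (ULift.{u} G₂))

variable {G₁ G₂}

/-- The embedding of the first factor of the free product. -/
def ofLeft : G₁ →* Monoid.CoprodI (Factor G₁ G₂) :=
  (Monoid.CoprodI.of (M := Factor G₁ G₂) (i := true)).comp
    (MulEquiv.ulift.symm : G₁ ≃* ULift.{v} G₁).toMonoidHom

/-- The embedding of the second factor of the free product. -/
def ofRight : G₂ →* Monoid.CoprodI (Factor G₁ G₂) :=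
  (Monoid.CoprodI.of (M := Factor G₁ G₂) (i := false)).comp
    (MulEquiv.ulift.symm : G₂ ≃* ULift.{u} G₂).toMonoidHom

open scoped Classical in
/-- The reduced word representing an element of the free product. -/
noncomputable def reducedWord (y : Monoid.Coprod G₁ G₂) : Monoid.CoprodI.Word (Factor G₁ G₂) :=
  Monoid.Coprod.lift ofLeft ofRight y • Monoid.CoprodI.Word.empty

lemma fstIdx_reducedWord_one :
    (reducedWord (1 : Monoid.Coprod G₁ G₂)).fstIdx = none := by
  rw [reducedWord, map_one, one_smul]
  rfl

lemma fstIdx_of_smul [∀ b, DecidableEq (Factor G₁ G₂ b)] {b : Bool} {m : Factor G₁ G₂ b}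
    (hm : m ≠ 1) {w : Monoid.CoprodI.Word (Factor G₁ G₂)} (hw : w.fstIdx ≠ some b) :
    (Monoid.CoprodI.of m • w).fstIdx = some b := by
  rw [← Monoid.CoprodI.Word.cons_eq_smul (h1 := hw) (h2 := hm)]
  exact Monoid.CoprodI.Word.fstIdx_cons _ _ _ _

lemma fstIdx_reducedWord_inl_mul {a : G₁} (ha : a ≠ 1) {y : Monoid.Coprod G₁ G₂}
    (hy : (reducedWord y).fstIdx ≠ some true) :
    (reducedWord (Monoid.Coprod.inl a * y)).fstIdx = some true := by
  classical
  rw [reducedWord, map_mul, mul_smul, Monoid.Coprod.lift_apply_inl]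
  exact fstIdx_of_smul (fun h => ha (MulEquiv.ulift.symm.map_eq_one_iff.1 h)) hy

lemma fstIdx_reducedWord_inr_mul {b : G₂} (hb : b ≠ 1) {y : Monoid.Coprod G₁ G₂}
    (hy : (reducedWord y).fstIdx ≠ some false) :
    (reducedWord (Monoid.Coprod.inr b * y)).fstIdx = some false := by
  classical
  rw [reducedWord, map_mul, mul_smul, Monoid.Coprod.lift_apply_inr]
  exact fstIdx_of_smul (fun h => hb (MulEquiv.ulift.symm.map_eq_one_iff.1 h)) hy

lemma isFreeProd_coprod (S₁ : Set G₁) (S₂ : Set G₂) :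
    IsFreeProd Monoid.Coprod.inl Monoid.Coprod.inr (setGens S₁) (setGens S₂) Sum.inl Sum.inr
      (coprodGens S₁ S₂) {y | (reducedWord y).fstIdx = some true}
      {y | (reducedWord y).fstIdx = some false} where
  gen_left _ := rfl
  gen_right _ := rfl
  injective_left := Sum.inl_injective
  injective_right := Sum.inr_injective
  cover j := by cases j <;> simp
  disjoint_gen j := by cases j <;> simp
  one_left h := by
    rw [Set.mem_ofPred_eq, fstIdx_reducedWord_one] at h
    cases h
  one_right h := by
    rw [Set.mem_ofPred_eq, fstIdx_reducedWord_one] at h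
    cases h
  disjoint x hx hx' := by
    rw [Set.mem_ofPred_eq] at hx hx'
    simp [hx] at hx'
  mul_left _ ha _ hy := fstIdx_reducedWord_inl_mul ha hy
  mul_right _ hb _ hy := fstIdx_reducedWord_inr_mul hb hy

lemma countable_coprod [Countable G₁] [Countable G₂] : Countable (Monoid.Coprod G₁ G₂) :=
  have : Countable (FreeMonoid (G₁ ⊕ G₂)) := inferInstanceAs (Countable (List (G₁ ⊕ G₂)))
  Monoid.Coprod.mk_surjective.countable

lemma countable_of_closure_eq_top {G : Type*} [Group G] {S : Set G} (hS : S.Finite)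
    (h : Subgroup.closure S = ⊤) : Countable G := by
  have := hS.countable.to_subtype
  have : Function.Surjective (FreeGroup.lift ((↑) : S → G)) := by
    rw [← MonoidHom.range_eq_top, FreeGroup.range_lift_eq_closure, Subtype.range_coe, h]
  exact this.countable

end Coprod

end Perc

namespace Perc

section Critical

open Filter Topology

variable {G ι : Type*} [Group G] {f : ι → G} {μ : ℝ → Measure (Config (G × ι))}

lemma exists_chi'_le_mul [Countable G] [Finite ι]
    (hμ : ∀ p ∈ Set.Icc (0 : ℝ) 1, IsBernoulli p (μ p)) {p q : ℝ} (hp : 0 ≤ p) (hpq : p < q)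
    (hq : q ≤ 1) : ∃ c < 1, chi' f (μ p) ≤ c * chi' f (μ q) := by
  have hq0 : 0 < q := hp.trans_lt hpq
  have hs : p / q < 1 := (div_lt_one hq0).2 hpq
  obtain ⟨n, hn⟩ := IsBernoulli.measure_conn_le_mul (f := f) hq0.le (hμ q ⟨hq0.le, hq⟩)
    (hμ (p / q) ⟨by positivity, hs.le⟩)
    (by rw [mul_div_cancel₀ _ hq0.ne']; exact hμ p ⟨hp, hpq.le.trans hq⟩)
  refine ⟨1 - ENNReal.ofReal (1 - p / q) ^ n,
    ENNReal.sub_lt_self one_ne_top one_ne_zero ?_, ?_⟩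
  · exact pow_ne_zero _ (by simpa using hs)
  · rw [chi', chi', ← ENNReal.tsum_mul_left]
    exact ENNReal.tsum_le_tsum fun x => hn x x.2

lemma chi'_zero [Countable G] [Finite ι]
    (hμ : ∀ p ∈ Set.Icc (0 : ℝ) 1, IsBernoulli p (μ p)) : chi' f (μ 0) = 0 := by
  obtain ⟨n, hn⟩ := IsBernoulli.measure_conn_le_mul (f := f) (p := 1) (s := 0) zero_le_one
    (hμ 1 (by simp)) (hμ 0 (by simp)) (by simpa using hμ 0 (by simp))
  rw [chi', ENNReal.tsum_eq_zero]
  exact fun x => by simpa using hn x x.2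

lemma le_chi' {p : ℝ} {ν : Measure (Config (G × ι))} (hν : IsBernoulli p ν) {i : ι}
    (hi : f i ≠ 1) : ENNReal.ofReal p ≤ chi' f ν := by
  have h := hν {(1, i)} fun _ => true
  simp only [if_true, Finset.prod_singleton, Finset.mem_singleton, forall_eq] at h
  rw [← h]
  refine le_trans (measure_mono fun ω hω => ?_)
    (ENNReal.le_tsum (f := fun y : {y : G // y ≠ 1} => ν {ω | Conn f ω 1 y}) ⟨f i, hi⟩)
  exact .single ⟨i, .inl ⟨hω, (one_mul _).symm⟩⟩

lemma exists_pow_mul_le_chi' [Countable G] [Countable ι]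
    (hμ : ∀ p ∈ Set.Icc (0 : ℝ) 1, IsBernoulli p (μ p)) {q : ℝ} (hq : q ∈ Set.Icc (0 : ℝ) 1)
    {c : ℝ≥0∞} (hc : c < chi' f (μ q)) :
    ∃ N : ℕ, ∀ s ∈ Set.Icc (0 : ℝ) 1, ENNReal.ofReal s ^ N * c ≤ chi' f (μ (q * s)) := by
  rw [chi', ENNReal.tsum_eq_iSup_sum, lt_iSup_iff] at hc
  obtain ⟨K, hK⟩ := hc
  simp_rw [measure_conn_eq_iSup] at hK
  rw [ENNReal.finsetSum_iSup_of_monotone, lt_iSup_iff] at hK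
  · obtain ⟨U, hU⟩ := hK
    refine ⟨U.card, fun s hs => ?_⟩
    calc ENNReal.ofReal s ^ U.card * c
        ≤ ENNReal.ofReal s ^ U.card * ∑ a ∈ K, μ q {ω | Conn f (restr U ω) 1 a} := by gcongr
      _ ≤ ∑ a ∈ K, μ (q * s) {ω | Conn f ω 1 a} := by
        rw [Finset.mul_sum]
        exact Finset.sum_le_sum fun a _ => IsBernoulli.pow_mul_measure_conn_le hq.1 (hμ q hq)
          (hμ s hs) (hμ _ ⟨mul_nonneg hq.1 hs.1, mul_le_one₀ hq.2 hs.1 hs.2⟩) U 1 a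
      _ ≤ _ := ENNReal.sum_le_tsum K
  · intro a U V hUV
    refine measure_mono fun ω hω => Conn.mono (fun e he => ?_) hω
    rw [restr_eq_true] at he ⊢
    exact ⟨he.1, hUV he.2⟩

lemma eventually_chi_ne_top [Countable G] [Finite ι]
    (hμ : ∀ p ∈ Set.Icc (0 : ℝ) 1, IsBernoulli p (μ p)) {q : ℝ} (hq : 0 ≤ q) (hq1 : q < 1)
    (hfin : chi f (μ q) ≠ ∞) : ∀ᶠ p in 𝓝[≥] q, chi f (μ p) ≠ ∞ := by
  have := Fintype.ofFinite ι
  have hcont : Continuous fun p : ℝ => ENNReal.ofReal ((p - q) / (1 - q)) :=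
    ENNReal.continuous_ofReal.comp (by fun_prop)
  have htend : Tendsto (fun p : ℝ =>
      chi f (μ q) * (2 * Fintype.card ι * ENNReal.ofReal ((p - q) / (1 - q)))) (𝓝 q) (𝓝 0) := by
    have h1 := ENNReal.Tendsto.const_mul (a := chi f (μ q) * (2 * Fintype.card ι))
      (hcont.tendsto q) (.inr (by finiteness))
    simpa [mul_assoc] using h1
  filter_upwards [nhdsWithin_le_nhds (htend.eventually_lt_const one_pos), self_mem_nhdsWithin,
    nhdsWithin_le_nhds (gt_mem_nhds hq1)] with p hlt hpq hp1
  have hpq' : q ≤ p := hpq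
  have hq1' : 0 < 1 - q := by linarith
  have hs0 : 0 ≤ (p - q) / (1 - q) := div_nonneg (by linarith) hq1'.le
  have hs1 : (p - q) / (1 - q) ≤ 1 := (div_le_one hq1').2 (by linarith)
  have hr := (hμ q ⟨hq, hq1.le⟩).isBern
  have ht := (hμ _ ⟨hs0, hs1⟩).isBern
  have hp := (hμ p ⟨hq.trans hpq', hp1.le⟩).isBern
  refine chi_ne_top_of_mul_lt_one hr ht ?_ hfin ?_
  · rwa [← ENNReal.ofReal_mul hq1'.le, mul_one_sub, mul_div_cancel₀ _ hq1'.ne', sub_sub,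
      add_sub_cancel]
  · rw [← ENNReal.ofReal_one, ← ENNReal.ofReal_sub _ (by linarith), _root_.sub_sub_cancel]
    simpa using hlt

lemma pc_mem_Icc : pc f μ ∈ Set.Icc (0 : ℝ) 1 := by
  have h0 : ∀ x ∈ {p | p ∈ Set.Icc (0 : ℝ) 1 ∧ 0 < theta f (μ p)} ∪ {1}, (0 : ℝ) ≤ x := by
    rintro x (hx | rfl)
    · exact hx.1.1
    · exact zero_le_one
  exact ⟨le_csInf ⟨1, .inr rfl⟩ h0, csInf_le ⟨0, h0⟩ (.inr rfl)⟩

lemma theta_nonpos_of_lt_pc {p : ℝ} (hp : 0 ≤ p) (hlt : p < pc f μ) : theta f (μ p) ≤ 0 := by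
  refine not_lt.1 fun h => notMem_of_lt_csInf hlt ⟨0, ?_⟩ (.inl ⟨⟨hp, ?_⟩, h⟩)
  · rintro x (hx | rfl)
    · exact hx.1.1
    · exact zero_le_one
  · exact hlt.le.trans pc_mem_Icc.2

lemma frequently_theta_pos (hlt : pc f μ < 1) : ∃ᶠ p in 𝓝[≥] (pc f μ), 0 < theta f (μ p) := by
  intro h
  obtain ⟨u, hu, hu'⟩ := (mem_nhdsGE_iff_exists_Ico_subset' hlt).1 h
  obtain ⟨x, hx, hxu⟩ := exists_lt_of_csInf_lt ⟨1, .inr rfl⟩ (lt_min hu hlt)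
  rcases hx with hx | rfl
  · refine hu' ⟨csInf_le ⟨0, ?_⟩ (.inl hx), hxu.trans_le (min_le_left _ _)⟩ hx.2
    rintro y (hy | rfl)
    · exact hy.1.1
    · exact zero_le_one
  · exact absurd hxu (not_lt.2 (min_le_right _ _))

end Critical

end Perc

namespace Perc

section FreeProductCritical

open Filter Topology

variable {Γ A B ι κ J : Type*} [Group Γ] [Group A] [Group B] [Countable A] [Countable B]
    {α : A →* Γ} {β : B →* Γ} {f : ι → A} {g : κ → B} {jA : ι → J} {jB : κ → J} {F : J → Γ}
    {LA LB : Set Γ} {μ : ℝ → Measure (Config (Γ × J))} {μA : ℝ → Measure (Config (A × ι))}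
    {μB : ℝ → Measure (Config (B × κ))}

lemma exists_lt_one_lt_chi'_mul [Countable ι] [Countable κ]
    (hA : ∀ p ∈ Set.Icc (0 : ℝ) 1, IsBernoulli p (μA p))
    (hB : ∀ p ∈ Set.Icc (0 : ℝ) 1, IsBernoulli p (μB p)) {q : ℝ} (hq : q ∈ Set.Ioc (0 : ℝ) 1)
    (hlt : 1 < chi' f (μA q) * chi' g (μB q)) :
    ∃ p, 0 ≤ p ∧ p < q ∧ 1 < chi' f (μA p) * chi' g (μB p) := by
  obtain ⟨c, hc, d, hd, hcd⟩ : ∃ c < chi' f (μA q), ∃ d < chi' g (μB q), 1 < c * d := by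
    by_contra! hcon
    exact hlt.not_ge (ENNReal.mul_le_of_forall_lt hcon)
  have hqI : q ∈ Set.Icc (0 : ℝ) 1 := ⟨hq.1.le, hq.2⟩
  obtain ⟨N, hN⟩ := exists_pow_mul_le_chi' hA hqI hc
  obtain ⟨M, hM⟩ := exists_pow_mul_le_chi' hB hqI hd
  have hcont : Continuous fun s : ℝ => ENNReal.ofReal s ^ (N + M) :=
    (ENNReal.continuous_pow _).comp ENNReal.continuous_ofReal
  have htend : Tendsto (fun s : ℝ => ENNReal.ofReal s ^ (N + M) * (c * d)) (𝓝 1) (𝓝 (c * d)) := by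
    have := ENNReal.Tendsto.mul_const (b := c * d) (hcont.tendsto 1)
      (.inr (ENNReal.mul_ne_top hc.ne_top hd.ne_top))
    simpa using this
  have hev : ∀ᶠ s in 𝓝[<] (1 : ℝ),
      1 < ENNReal.ofReal s ^ (N + M) * (c * d) ∧ s < 1 ∧ 0 < s := by
    filter_upwards [nhdsWithin_le_nhds (htend.eventually_const_lt hcd), self_mem_nhdsWithin,
      nhdsWithin_le_nhds (lt_mem_nhds zero_lt_one)] with s h1 h2 h3 using ⟨h1, h2, h3⟩
  obtain ⟨s, hs, hs1, hs0⟩ := hev.exists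
  refine ⟨q * s, mul_nonneg hq.1.le hs0.le, mul_lt_of_lt_one_right hq.1 hs1, hs.trans_le ?_⟩
  calc ENNReal.ofReal s ^ (N + M) * (c * d)
      = (ENNReal.ofReal s ^ N * c) * (ENNReal.ofReal s ^ M * d) := by ring
    _ ≤ _ := mul_le_mul' (hN s ⟨hs0.le, hs1.le⟩) (hM s ⟨hs0.le, hs1.le⟩)

lemma chi'_mul_lt_one_of_lt [Finite ι] [Finite κ]
    (hA : ∀ p ∈ Set.Icc (0 : ℝ) 1, IsBernoulli p (μA p))
    (hB : ∀ p ∈ Set.Icc (0 : ℝ) 1, IsBernoulli p (μB p)) {p q : ℝ} (hp : 0 ≤ p) (hpq : p < q)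
    (hq : q ≤ 1) (h : chi' f (μA q) * chi' g (μB q) = 1) :
    chi' f (μA p) * chi' g (μB p) < 1 := by
  obtain ⟨c, hc, hc'⟩ := exists_chi'_le_mul (f := f) hA hp hpq hq
  obtain ⟨d, hd, hd'⟩ := exists_chi'_le_mul (f := g) hB hp hpq hq
  calc chi' f (μA p) * chi' g (μB p)
      ≤ (c * chi' f (μA q)) * (d * chi' g (μB q)) := mul_le_mul' hc' hd'
    _ = c * d * (chi' f (μA q) * chi' g (μB q)) := by ring
    _ = c * d := by rw [h, mul_one]
    _ < 1 := mul_lt_one_of_lt_of_le hc hd.le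

namespace IsFreeProd

lemma chi'_mul_pc_le_one [Finite ι] [Finite κ] (h : IsFreeProd α β f g jA jB F LA LB)
    (hA : ∀ p ∈ Set.Icc (0 : ℝ) 1, IsBernoulli p (μA p))
    (hB : ∀ p ∈ Set.Icc (0 : ℝ) 1, IsBernoulli p (μB p))
    (hμ : ∀ p ∈ Set.Icc (0 : ℝ) 1, IsBernoulli p (μ p)) :
    chi' f (μA (pc F μ)) * chi' g (μB (pc F μ)) ≤ 1 := by
  have hpc := pc_mem_Icc (f := F) (μ := μ)
  rcases hpc.1.eq_or_lt with h0 | h0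
  · simp [← h0, chi'_zero hA]
  · by_contra! hlt
    obtain ⟨p, hp0, hp, hp'⟩ := exists_lt_one_lt_chi'_mul hA hB ⟨h0, hpc.2⟩ hlt
    have hpI : p ∈ Set.Icc (0 : ℝ) 1 := ⟨hp0, hp.le.trans hpc.2⟩
    have := (hμ p hpI).isBern.isProbabilityMeasure
    refine (theta_nonpos_of_lt_pc hp0 hp).not_gt (ENNReal.toReal_pos ?_ (measure_ne_top _ _))
    exact h.measure_infinite_ne_zero (hμ p hpI).isBern (hA p hpI).isBern (hB p hpI).isBern hp'

lemma one_le_chi'_mul_pc [Countable Γ] [Finite ι] [Finite κ] [Finite J]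
    (h : IsFreeProd α β f g jA jB F LA LB)
    (hA : ∀ p ∈ Set.Icc (0 : ℝ) 1, IsBernoulli p (μA p))
    (hB : ∀ p ∈ Set.Icc (0 : ℝ) 1, IsBernoulli p (μB p))
    (hμ : ∀ p ∈ Set.Icc (0 : ℝ) 1, IsBernoulli p (μ p)) (hf : ∃ i, f i ≠ 1) (hg : ∃ k, g k ≠ 1) :
    1 ≤ chi' f (μA (pc F μ)) * chi' g (μB (pc F μ)) := by
  obtain ⟨i, hi⟩ := hf
  obtain ⟨k, hk⟩ := hg
  have hpc := pc_mem_Icc (f := F) (μ := μ)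
  have hleA := le_chi' (hA _ hpc) hi
  have hleB := le_chi' (hB _ hpc) hk
  set q := pc F μ with hq
  rcases hpc.2.eq_or_lt with h1 | h1
  · rw [h1, ENNReal.ofReal_one] at hleA hleB
    rw [h1]
    exact one_le_mul hleA hleB
  · by_contra! hlt
    have hfin : chi' f (μA q) ≠ ∞ ∧ chi' g (μB q) ≠ ∞ := by
      rcases hpc.1.eq_or_lt with h0 | h0
      · simp [← h0, chi'_zero hA, chi'_zero hB]
      · have h0' := ENNReal.ofReal_pos.2 h0
        refine ⟨fun ht => ?_, fun ht => ?_⟩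
        · rw [ht, ENNReal.top_mul (h0'.trans_le hleB).ne'] at hlt
          exact not_top_lt hlt
        · rw [ht, ENNReal.mul_top (h0'.trans_le hleA).ne'] at hlt
          exact not_top_lt hlt
    have hchi := h.chi_ne_top (hμ q hpc).isBern (hA q hpc).isBern (hB q hpc).isBern hfin.1 hfin.2 hlt
    refine frequently_theta_pos h1 ?_
    filter_upwards [eventually_chi_ne_top hμ hpc.1 h1 hchi] with p hp
    simp [theta, measure_infinite_eq_zero hp]

end IsFreeProd

lemma exists_setGens_ne_one {G : Type*} [Group G] [Nontrivial G] {S : Set G}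
    (h : Subgroup.closure S = ⊤) : ∃ i, setGens S i ≠ 1 := by
  by_contra! hcon
  have : Subgroup.closure S = ⊥ := Subgroup.closure_eq_bot_iff.2 fun x hx => hcon ⟨x, hx⟩
  exact bot_ne_top (this.symm.trans h)

end FreeProductCritical

end Perc

/-- For nontrivial finitely generated groups `G₁, G₂` with finite
generating sets `S₁, S₂`, there is a unique `p₀ ∈ (0,1]` with
`(χ₁(p₀) - 1)·(χ₂(p₀) - 1) = 1` (an equation in `[0,∞]`), and `p₀` is the critical
probability of the Cayley graph of the free product `G₁ * G₂` w.r.t. `S₁ ⊔ S₂`. -/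
theorem critical_probability_free_product_two
    {G₁ G₂ : Type*} [Group G₁] [Group G₂] [Nontrivial G₁] [Nontrivial G₂]
    (S₁ : Set G₁) (S₂ : Set G₂) (hfin₁ : S₁.Finite) (hfin₂ : S₂.Finite)
    (hgen₁ : Subgroup.closure S₁ = ⊤) (hgen₂ : Subgroup.closure S₂ = ⊤)
    (μ₁ : ℝ → Measure (Config (G₁ × S₁))) (μ₂ : ℝ → Measure (Config (G₂ × S₂)))
    (μ : ℝ → Measure (Config (Monoid.Coprod G₁ G₂ × (S₁ ⊕ S₂))))
    (hμ₁ : ∀ p ∈ Set.Icc (0 : ℝ) 1, IsBernoulli p (μ₁ p))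
    (hμ₂ : ∀ p ∈ Set.Icc (0 : ℝ) 1, IsBernoulli p (μ₂ p))
    (hμ : ∀ p ∈ Set.Icc (0 : ℝ) 1, IsBernoulli p (μ p)) :
    (∃! p₀ : ℝ, p₀ ∈ Set.Ioc (0 : ℝ) 1 ∧
      (chi (setGens S₁) (μ₁ p₀) - 1) * (chi (setGens S₂) (μ₂ p₀) - 1) = 1) ∧
    pc (coprodGens S₁ S₂) μ ∈ Set.Ioc (0 : ℝ) 1 ∧
    (chi (setGens S₁) (μ₁ (pc (coprodGens S₁ S₂) μ)) - 1) *
      (chi (setGens S₂) (μ₂ (pc (coprodGens S₁ S₂) μ)) - 1) = 1 := by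
  have := countable_of_closure_eq_top hfin₁ hgen₁
  have := countable_of_closure_eq_top hfin₂ hgen₂
  have := countable_coprod (G₁ := G₁) (G₂ := G₂)
  have := hfin₁.to_subtype
  have := hfin₂.to_subtype
  have h := isFreeProd_coprod S₁ S₂
  have hpc := pc_mem_Icc (f := coprodGens S₁ S₂) (μ := μ)
  have hchi (p : ℝ) (hp : p ∈ Set.Icc (0 : ℝ) 1) :
      (chi (setGens S₁) (μ₁ p) - 1) * (chi (setGens S₂) (μ₂ p) - 1) =
        chi' (setGens S₁) (μ₁ p) * chi' (setGens S₂) (μ₂ p) := by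
    have := (hμ₁ p hp).isBern.isProbabilityMeasure
    have := (hμ₂ p hp).isBern.isProbabilityMeasure
    rw [chi_sub_one, chi_sub_one]
  have hone := le_antisymm (h.chi'_mul_pc_le_one hμ₁ hμ₂ hμ) (h.one_le_chi'_mul_pc hμ₁ hμ₂ hμ
    (exists_setGens_ne_one hgen₁) (exists_setGens_ne_one hgen₂))
  have hpos : 0 < pc (coprodGens S₁ S₂) μ := by
    refine hpc.1.lt_of_ne fun h0 => ?_
    rw [← h0, chi'_zero hμ₁, zero_mul] at hone
    exact zero_ne_one hone
  have heq := (hchi _ hpc).trans hone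
  refine ⟨⟨pc (coprodGens S₁ S₂) μ, ⟨⟨hpos, hpc.2⟩, heq⟩, ?_⟩, ⟨hpos, hpc.2⟩, heq⟩
  rintro p ⟨hp, hp'⟩
  rw [hchi p ⟨hp.1.le, hp.2⟩] at hp'
  rcases lt_trichotomy p (pc (coprodGens S₁ S₂) μ) with hlt | rfl | hlt
  · exact absurd hp' (chi'_mul_lt_one_of_lt hμ₁ hμ₂ hp.1.le hlt hpc.2 hone).ne
  · rfl
  · exact absurd hone (chi'_mul_lt_one_of_lt hμ₁ hμ₂ hpc.1 hlt hp.2 hp').ne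
end

section
/- Let G₁ and G₂ be nontrivial finitely generated groups with finite generating sets S₁ and S₂. The critical probability p_c of Bernoulli bond percolation on the Cayley graph of the free product G₁*G₂ with respect to S₁ ⊔ S₂ equals 1 if and only if both G₁ and G₂ have exactly two elements. -/
open MeasureTheory ENNReal

namespace Perc

open ProbabilityTheory

section Bernoulli

variable {E : Type*} {p : ℝ} {μ : Measure (Config E)}

theorem IsBernoulli.isProbabilityMeasure (h : IsBernoulli p μ) : IsProbabilityMeasure μ :=
  ⟨by simpa using h ∅ fun _ => true⟩

theorem IsBernoulli.measure_forall_open (h : IsBernoulli p μ) (F : Finset E) :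
    μ {ω | ∀ e ∈ F, ω e = true} = ENNReal.ofReal p ^ F.card := by
  simpa using h F fun _ => true

theorem IsBernoulli.measure_forall_closed (h : IsBernoulli p μ) (F : Finset E) :
    μ {ω | ∀ e ∈ F, ω e = false} = ENNReal.ofReal (1 - p) ^ F.card := by
  simpa using h F fun _ => false

theorem IsBernoulli.iIndepFun_apply (h : IsBernoulli p μ) :
    iIndepFun (fun e (ω : Config E) => ω e) μ := by
  have hmeas : ∀ e : E, MeasurableSet {ω : Config E | ω e = true} := fun e =>
    (measurable_pi_apply e : Measurable fun ω : Config E => ω e) (measurableSet_singleton true)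
  have hset : iIndepSet (fun e : E => {ω : Config E | ω e = true}) μ := by
    rw [iIndepSet_iff_meas_biInter hmeas]
    intro s
    have h₁ : ∀ e : E, μ {ω | ω e = true} = ENNReal.ofReal p := fun e => by
      simpa using h.measure_forall_open {e}
    have h₂ : (⋂ e ∈ s, {ω : Config E | ω e = true}) = {ω | ∀ e ∈ s, ω e = true} := by
      ext ω; simp
    rw [h₂, h.measure_forall_open]
    simp [h₁]
  rw [iIndepSet_iff_iIndep] at hset
  have hgen : (⊤ : MeasurableSpace Bool) = MeasurableSpace.generateFrom {{true}} := by
    refine le_antisymm (fun s _ => ?_) le_top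
    have ht : MeasurableSet[MeasurableSpace.generateFrom {{true}}] ({true} : Set Bool) :=
      MeasurableSpace.measurableSet_generateFrom rfl
    have hf : MeasurableSet[MeasurableSpace.generateFrom {{true}}] ({false} : Set Bool) := by
      have : ({false} : Set Bool) = {true}ᶜ := by ext b; cases b <;> simp
      rw [this]
      exact ht.compl
    have hs : s = ⋃ b ∈ s, {b} := by simp
    rw [hs]
    refine MeasurableSet.biUnion s.to_countable fun b _ => ?_
    cases b
    · exact hf
    · exact ht
  rw [iIndepFun_iff_iIndep]
  convert hset using 2 with e
  change MeasurableSpace.comap _ (⊤ : MeasurableSpace Bool) = _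
  rw [hgen, MeasurableSpace.comap_generateFrom]
  congr 1
  simp only [Set.image_singleton]
  rfl

theorem exists_eq_preimage_of_dependsOn {A : Set (Config E)} {F : Finset E}
    (hA : DependsOn (· ∈ A) (F : Set E)) :
    ∃ A' : Set (F → Bool), A = (fun ω (e : F) => ω e) ⁻¹' A' := by
  refine ⟨(fun ω (e : F) => ω e) '' A, (Set.subset_preimage_image _ _).antisymm ?_⟩
  rintro ω ⟨ω', hω', heq⟩
  exact (hA (x := ω) (y := ω') fun e he => (congrFun heq ⟨e, he⟩).symm).mpr hω'

theorem measurable_finset_restrict (F : Finset E) :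
    Measurable fun (ω : Config E) (e : F) => ω e :=
  measurable_pi_lambda _ fun e => measurable_pi_apply (e : E)

theorem measurableSet_of_dependsOn {A : Set (Config E)} {F : Finset E}
    (hA : DependsOn (· ∈ A) (F : Set E)) : MeasurableSet A := by
  obtain ⟨A', rfl⟩ := exists_eq_preimage_of_dependsOn hA
  exact measurable_finset_restrict F (Set.toFinite A').measurableSet

/-- Events determined by disjoint finite sets of edges are independent. -/
theorem IsBernoulli.real_inter_eq_mul (h : IsBernoulli p μ) {A B : Set (Config E)}
    {F F' : Finset E} (hA : DependsOn (· ∈ A) (F : Set E))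
    (hB : DependsOn (· ∈ B) (F' : Set E)) (hF : Disjoint F F') :
    μ.real (A ∩ B) = μ.real A * μ.real B := by
  obtain ⟨A', rfl⟩ := exists_eq_preimage_of_dependsOn hA
  obtain ⟨B', rfl⟩ := exists_eq_preimage_of_dependsOn hB
  have := (h.iIndepFun_apply.indepFun_finset F F' hF fun e =>
    measurable_pi_apply e).measure_inter_preimage_eq_mul A' B'
    (Set.toFinite A').measurableSet (Set.toFinite B').measurableSet
  rw [Measure.real, this, ENNReal.toReal_mul, Measure.real, Measure.real]

theorem dependsOn_forall_open (F : Finset E) :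
    DependsOn (· ∈ {ω : Config E | ∀ e ∈ F, ω e = true}) (F : Set E) := by
  intro ω ω' hω
  simp only [Set.mem_ofPred_eq, eq_iff_iff]
  exact forall₂_congr fun e he => by rw [hω e he]

theorem dependsOn_exists_open (F : Finset E) :
    DependsOn (· ∈ {ω : Config E | ∃ e ∈ F, ω e = true}) (F : Set E) := by
  intro ω ω' hω
  simp only [Set.mem_ofPred_eq, eq_iff_iff]
  exact exists_congr fun e => and_congr_right fun he => by rw [hω e he]

theorem IsBernoulli.real_exists_open_le (h : IsBernoulli p μ) (hp : p ∈ Set.Icc (0 : ℝ) 1)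
    {F : Finset E} {k : ℕ} (hk : F.card ≤ k) :
    μ.real {ω | ∃ e ∈ F, ω e = true} ≤ 1 - (1 - p) ^ k := by
  have := h.isProbabilityMeasure
  have hcompl : {ω : Config E | ∃ e ∈ F, ω e = true} = {ω | ∀ e ∈ F, ω e = false}ᶜ := by
    ext ω; simp
  have hclosed : μ.real {ω | ∀ e ∈ F, ω e = false} = (1 - p) ^ F.card := by
    rw [Measure.real, h.measure_forall_closed, ENNReal.toReal_pow,
      ENNReal.toReal_ofReal (sub_nonneg.mpr hp.2)]
  have hmeas : MeasurableSet {ω : Config E | ∀ e ∈ F, ω e = false} := by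
    rw [← MeasurableSet.compl_iff, ← hcompl]
    exact measurableSet_of_dependsOn (dependsOn_exists_open F)
  rw [hcompl, probReal_compl_eq_one_sub hmeas, hclosed]
  have : (1 - p) ^ k ≤ (1 - p) ^ F.card :=
    pow_le_pow_of_le_one (sub_nonneg.mpr hp.2) (by linarith [hp.1]) hk
  linarith

/-- Below parameter `1`, almost surely some member of an infinite family of disjoint sets of
edges of bounded cardinality is entirely closed. -/
theorem IsBernoulli.measure_forall_exists_open (h : IsBernoulli p μ)
    (hp : p ∈ Set.Icc (0 : ℝ) 1) (hp1 : p < 1) {F : ℕ → Finset E}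
    (hF : Pairwise (Function.onFun Disjoint F)) {k : ℕ} (hk : ∀ n, (F n).card ≤ k) :
    μ {ω | ∀ n, ∃ e ∈ F n, ω e = true} = 0 := by
  classical
  have := h.isProbabilityMeasure
  set c : ℝ := 1 - (1 - p) ^ k with hc
  have hpos : 0 < (1 - p) ^ k := pow_pos (by linarith) k
  have hc0 : 0 ≤ c := sub_nonneg.mpr (pow_le_one₀ (by linarith) (by linarith [hp.1]))
  have hdep : ∀ n, DependsOn (· ∈ {ω : Config E | ∀ m < n, ∃ e ∈ F m, ω e = true})
      (((Finset.range n).biUnion F : Finset E) : Set E) := by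
    intro n ω ω' hω
    simp only [Set.mem_ofPred_eq, eq_iff_iff]
    refine forall₂_congr fun m hm => exists_congr fun e => and_congr_right fun he => ?_
    rw [hω e (by simpa using ⟨m, hm, he⟩)]
  have hle : ∀ n, μ.real {ω | ∀ m < n, ∃ e ∈ F m, ω e = true} ≤ c ^ n := by
    intro n
    induction n with
    | zero => simp
    | succ n ih =>
      have hsplit : {ω : Config E | ∀ m < n + 1, ∃ e ∈ F m, ω e = true} =
          {ω | ∀ m < n, ∃ e ∈ F m, ω e = true} ∩ {ω | ∃ e ∈ F n, ω e = true} := by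
        ext ω
        simp only [Set.mem_ofPred_eq, Set.mem_inter_iff]
        exact Nat.forall_lt_succ_right
      rw [hsplit, h.real_inter_eq_mul (hdep n) (dependsOn_exists_open (F n)), pow_succ]
      · exact mul_le_mul ih (h.real_exists_open_le hp (hk n)) measureReal_nonneg (pow_nonneg hc0 n)
      · rw [Finset.disjoint_biUnion_left]
        exact fun m hm => hF (Finset.mem_range.mp hm).ne
  have hzero : μ.real {ω | ∀ n, ∃ e ∈ F n, ω e = true} ≤ 0 :=
    ge_of_tendsto' (tendsto_pow_atTop_nhds_zero_of_lt_one hc0 (by linarith)) fun n =>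
      (measureReal_mono (Set.ofPred_subset_ofPred.mpr fun ω hω m _ => hω m)).trans (hle n)
  exact (measureReal_eq_zero_iff).mp (hzero.antisymm measureReal_nonneg)

end Bernoulli

section Cayley

variable {G ι : Type*} [Group G] {f : ι → G} {ω : Config (G × ι)} {x y : G}

theorem Conn.symm (h : Conn f ω x y) : Conn f ω y x := by
  have : Std.Symm (Step f ω) := ⟨fun a b ⟨i, hi⟩ => ⟨i, hi.symm⟩⟩
  exact Relation.ReflTransGen.stdSymm.symm _ _ h

/-- Left translation of edges of a Cayley graph. -/
def edgeTranslate (g : G) (e : G × ι) : G × ι := (g * e.1, e.2)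

@[simp]
theorem edgeTranslate_one (e : G × ι) : edgeTranslate 1 e = e := by
  simp [edgeTranslate]

theorem edgeTranslate_mul (g h : G) (e : G × ι) :
    edgeTranslate (g * h) e = edgeTranslate g (edgeTranslate h e) := by
  simp [edgeTranslate, mul_assoc]

theorem edgeTranslate_injective (g : G) :
    Function.Injective (edgeTranslate g : G × ι → G × ι) := by
  rintro ⟨a, i⟩ ⟨b, j⟩ h
  simpa [edgeTranslate] using h

theorem Conn.translate (g : G) (h : Conn f (fun e => ω (edgeTranslate g e)) x y) :
    Conn f ω (g * x) (g * y) := by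
  refine Relation.ReflTransGen.lift (g * ·) (fun a b hab => ?_) _ _ h
  obtain ⟨i, ⟨h, rfl⟩ | ⟨h, rfl⟩⟩ := hab
  · exact ⟨i, .inl ⟨h, (mul_assoc _ _ _).symm⟩⟩
  · exact ⟨i, .inr ⟨h, (mul_assoc _ _ _).symm⟩⟩

/-- An element of the subgroup generated by the images `φ s` of some generators is joined to
the identity by a finite set of edges inside that subgroup. -/
theorem exists_finset_conn {H : Type*} [Group H] {S : Set H} (φ : H →* G) (j : S → ι)
    (hj : ∀ s, f (j s) = φ s) {x : H} (hx : x ∈ Subgroup.closure S) :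
    ∃ B : Finset (G × ι), (∀ e ∈ B, e.1 ∈ Set.range φ ∧ e.2 ∈ Set.range j) ∧
      ∀ ω : Config (G × ι), (∀ e ∈ B, ω e = true) → Conn f ω 1 (φ x) := by
  classical
  induction hx using Subgroup.closure_induction with
  | mem s hs =>
    refine ⟨{(1, j ⟨s, hs⟩)}, ?_, fun ω hω => .single ⟨j ⟨s, hs⟩, .inl ⟨hω _ (by simp), ?_⟩⟩⟩
    · simp only [Finset.mem_singleton, forall_eq]
      exact ⟨⟨1, map_one φ⟩, ⟨_, rfl⟩⟩
    · simp [hj]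
  | one => exact ⟨∅, by simp, fun ω _ => by rw [map_one]; exact .refl⟩
  | mul x y _ _ hx hy =>
    obtain ⟨B, hB, hBx⟩ := hx
    obtain ⟨B', hB', hBy⟩ := hy
    refine ⟨B ∪ B'.image (edgeTranslate (φ x)), fun e he => ?_, fun ω hω => ?_⟩
    · rcases Finset.mem_union.mp he with he | he
      · exact hB e he
      · obtain ⟨e', he', rfl⟩ := Finset.mem_image.mp he
        obtain ⟨⟨z, hz⟩, hj'⟩ := hB' e' he'
        exact ⟨⟨x * z, by simp [edgeTranslate, hz]⟩, hj'⟩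
    · have h₁ := hBx ω fun e he => hω e (Finset.mem_union_left _ he)
      have h₂ := (hBy (fun e => ω (edgeTranslate (φ x) e)) fun e he =>
        hω _ (Finset.mem_union_right _ (Finset.mem_image_of_mem _ he))).translate
      rw [mul_one, ← map_mul] at h₂
      exact h₁.trans h₂
  | inv x _ hx =>
    obtain ⟨B, hB, hBx⟩ := hx
    refine ⟨B.image (edgeTranslate (φ x)⁻¹), fun e he => ?_, fun ω hω => ?_⟩
    · obtain ⟨e', he', rfl⟩ := Finset.mem_image.mp he
      obtain ⟨⟨z, hz⟩, hj'⟩ := hB e' he'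
      exact ⟨⟨x⁻¹ * z, by simp [edgeTranslate, hz]⟩, hj'⟩
    · have h₂ := (hBx (fun e => ω (edgeTranslate (φ x)⁻¹ e)) fun e he =>
        hω _ (Finset.mem_image_of_mem _ he)).translate
      rw [mul_one, inv_mul_cancel, ← map_inv] at h₂
      exact h₂.symm

end Cayley

end Perc

namespace Perc

section Tree

variable {G ι : Type*} [Group G] (t : Bool → G) (B : Finset (G × ι))

/-- The event that, in the binary tree rooted at `g` with children `x * t true` and
`x * t false` of each vertex `x`, some path from `g` down to depth `n` has at each of its
vertices except the last all edges in the translate of `B` open. -/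
def treeEvent : ℕ → G → Set (Config (G × ι))
  | 0, _ => Set.univ
  | n + 1, g => {ω | ∀ e ∈ B, ω (edgeTranslate g e) = true} ∩
      (treeEvent n (g * t true) ∪ treeEvent n (g * t false))

open scoped Classical in
/-- The finite set of edges on which `treeEvent t B n g` depends. -/
noncomputable def treeEdges : ℕ → G → Finset (G × ι)
  | 0, _ => ∅
  | n + 1, g => B.image (edgeTranslate g) ∪
      (treeEdges n (g * t true) ∪ treeEdges n (g * t false))

theorem treeEvent_succ_subset (n : ℕ) (g : G) : treeEvent t B (n + 1) g ⊆ treeEvent t B n g := by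
  induction n generalizing g with
  | zero => exact Set.subset_univ _
  | succ n ih => exact Set.inter_subset_inter_right _ (Set.union_subset_union (ih _) (ih _))

theorem DependsOn.inter_mem {E : Type*} {A A' : Set (Config E)} {F F' : Set E}
    (hA : DependsOn (· ∈ A) F) (hA' : DependsOn (· ∈ A') F') :
    DependsOn (· ∈ A ∩ A') (F ∪ F') := fun ω ω' hω => by
  have h₁ := hA fun e he => hω e (Or.inl he)
  have h₂ := hA' fun e he => hω e (Or.inr he)
  exact congrArg₂ And h₁ h₂

theorem DependsOn.union_mem {E : Type*} {A A' : Set (Config E)} {F F' : Set E}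
    (hA : DependsOn (· ∈ A) F) (hA' : DependsOn (· ∈ A') F') :
    DependsOn (· ∈ A ∪ A') (F ∪ F') := fun ω ω' hω => by
  have h₁ := hA fun e he => hω e (Or.inl he)
  have h₂ := hA' fun e he => hω e (Or.inr he)
  exact congrArg₂ Or h₁ h₂

open scoped Classical in
theorem setOf_forall_edgeTranslate (g : G) :
    {ω : Config (G × ι) | ∀ e ∈ B, ω (edgeTranslate g e) = true} =
      {ω | ∀ e ∈ B.image (edgeTranslate g), ω e = true} := by
  simp only [Finset.forall_mem_image]

theorem dependsOn_treeEvent (n : ℕ) (g : G) :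
    DependsOn (· ∈ treeEvent t B n g) (treeEdges t B n g : Set (G × ι)) := by
  classical
  induction n generalizing g with
  | zero => intro ω ω' _; simp [treeEvent]
  | succ n ih =>
    simp only [treeEdges, Finset.coe_union]
    refine DependsOn.inter_mem ?_ (DependsOn.union_mem (ih _) (ih _))
    rw [setOf_forall_edgeTranslate]
    exact dependsOn_forall_open _

variable {t B} {T : Set (G × ι)}

theorem exists_of_mem_treeEdges (hB : ∀ e ∈ B, e ∈ T)
    (hT : ∀ c, ∀ e ∈ T, edgeTranslate (t c) e ∈ T) {n : ℕ} {g : G} {e : G × ι}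
    (he : e ∈ treeEdges t B n g) : ∃ e' ∈ T, edgeTranslate g e' = e := by
  classical
  induction n generalizing g with
  | zero => simp [treeEdges] at he
  | succ n ih =>
    simp only [treeEdges, Finset.mem_union, Finset.mem_image] at he
    obtain ⟨e', he', rfl⟩ | he | he := he
    · exact ⟨e', hB e' he', rfl⟩
    · obtain ⟨e', he', rfl⟩ := ih he
      exact ⟨_, hT true e' he', (edgeTranslate_mul _ _ _).symm⟩
    · obtain ⟨e', he', rfl⟩ := ih he
      exact ⟨_, hT false e' he', (edgeTranslate_mul _ _ _).symm⟩

theorem IsBernoulli.half_le_real_treeEvent {p : ℝ} {μ : Measure (Config (G × ι))}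
    (h : IsBernoulli p μ) (hp : p ∈ Set.Icc (0 : ℝ) 1) (hpB : 2 / 3 ≤ p ^ B.card)
    (hB : ∀ e ∈ B, e ∈ T) (hT : ∀ c, ∀ e ∈ T, edgeTranslate (t c) e ∈ T)
    (hBT : ∀ c, ∀ e ∈ T, edgeTranslate (t c) e ∉ B)
    (htf : ∀ e ∈ T, ∀ e' ∈ T, edgeTranslate (t true) e ≠ edgeTranslate (t false) e')
    (n : ℕ) (g : G) : 1 / 2 ≤ μ.real (treeEvent t B n g) := by
  classical
  have := h.isProbabilityMeasure
  induction n generalizing g with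
  | zero => simp only [treeEvent, probReal_univ]; norm_num
  | succ n ih =>
    have hmem : ∀ c, ∀ e ∈ treeEdges t B n (g * t c),
        ∃ e' ∈ T, edgeTranslate g (edgeTranslate (t c) e') = e := fun c e he => by
      obtain ⟨e', he', h⟩ := exists_of_mem_treeEdges hB hT he
      exact ⟨e', he', by rw [← edgeTranslate_mul, h]⟩
    have hroot : ∀ c, Disjoint (B.image (edgeTranslate g)) (treeEdges t B n (g * t c)) := by
      refine fun c => Finset.disjoint_left.mpr fun e he he' => ?_
      obtain ⟨e₁, he₁, rfl⟩ := Finset.mem_image.mp he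
      obtain ⟨e₂, he₂, heq⟩ := hmem c _ he'
      exact hBT c e₂ he₂ (edgeTranslate_injective g heq ▸ he₁)
    have hsub : Disjoint (treeEdges t B n (g * t true)) (treeEdges t B n (g * t false)) := by
      refine Finset.disjoint_left.mpr fun e he he' => ?_
      obtain ⟨e₁, he₁, heq₁⟩ := hmem true _ he
      obtain ⟨e₂, he₂, heq₂⟩ := hmem false _ he'
      exact htf e₁ he₁ e₂ he₂ (edgeTranslate_injective g (heq₁.trans heq₂.symm))
    have hdep := dependsOn_treeEvent t B n
    have hq : 2 / 3 ≤ μ.real {ω | ∀ e ∈ B, ω (edgeTranslate g e) = true} := by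
      rw [setOf_forall_edgeTranslate, Measure.real, h.measure_forall_open, ENNReal.toReal_pow,
        ENNReal.toReal_ofReal hp.1, Finset.card_image_of_injective _ (edgeTranslate_injective g)]
      exact hpB
    have hunion : 3 / 4 ≤ μ.real (treeEvent t B n (g * t true) ∪ treeEvent t B n (g * t false)) := by
      have h₁ := measureReal_union_add_inter (μ := μ) (s := treeEvent t B n (g * t true))
        (measurableSet_of_dependsOn (hdep (g * t false)))
      rw [h.real_inter_eq_mul (hdep _) (hdep _) hsub] at h₁
      nlinarith [ih (g * t true), ih (g * t false),
        measureReal_le_one (μ := μ) (s := treeEvent t B n (g * t true)),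
        measureReal_le_one (μ := μ) (s := treeEvent t B n (g * t false))]
    rw [treeEvent, h.real_inter_eq_mul (F := B.image (edgeTranslate g))
      (F' := treeEdges t B n (g * t true) ∪ treeEdges t B n (g * t false))]
    · nlinarith
    · rw [setOf_forall_edgeTranslate]
      exact dependsOn_forall_open _
    · rw [Finset.coe_union]
      exact DependsOn.union_mem (hdep _) (hdep _)
    · exact Finset.disjoint_union_right.mpr ⟨hroot true, hroot false⟩

theorem exists_conn_of_mem_treeEvent {f : ι → G}
    (hconn : ∀ c, ∀ ω : Config (G × ι), (∀ e ∈ B, ω e = true) → Conn f ω 1 (t c))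
    {n : ℕ} {g : G} {ω : Config (G × ι)} (hω : ω ∈ treeEvent t B n g) :
    ∃ w : List Bool, w.length = n ∧ Conn f ω g (g * (w.map t).prod) := by
  induction n generalizing g with
  | zero => exact ⟨[], rfl, by rw [List.map_nil, List.prod_nil, mul_one]; exact .refl⟩
  | succ n ih =>
    obtain ⟨hroot, hsub⟩ := hω
    have key : ∀ c, ω ∈ treeEvent t B n (g * t c) →
        ∃ w : List Bool, w.length = n + 1 ∧ Conn f ω g (g * (w.map t).prod) := by
      intro c hc
      obtain ⟨w, hw, hconn'⟩ := ih hc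
      refine ⟨c :: w, by simp [hw], ?_⟩
      have := (hconn c _ hroot).translate
      rw [mul_one] at this
      rw [List.map_cons, List.prod_cons, ← mul_assoc]
      exact this.trans hconn'
    exact hsub.elim (key true) (key false)

theorem injective_prod_map (hne : B.Nonempty)
    (hB : ∀ e ∈ B, e ∈ T) (hT : ∀ c, ∀ e ∈ T, edgeTranslate (t c) e ∈ T)
    (hBT : ∀ c, ∀ e ∈ T, edgeTranslate (t c) e ∉ B)
    (htf : ∀ e ∈ T, ∀ e' ∈ T, edgeTranslate (t true) e ≠ edgeTranslate (t false) e') :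
    Function.Injective fun w : List Bool => (w.map t).prod := by
  obtain ⟨e, he⟩ := hne
  have hmem : ∀ w : List Bool, edgeTranslate (w.map t).prod e ∈ T := by
    intro w
    induction w with
    | nil => simpa using hB e he
    | cons c w ih => simpa [edgeTranslate_mul] using hT c _ ih
  have hcons : ∀ (c : Bool) (w : List Bool), t c * (w.map t).prod ≠ 1 := by
    intro c w hw
    refine hBT c _ (hmem w) ?_
    rwa [← edgeTranslate_mul, hw, edgeTranslate_one]
  intro w
  induction w with
  | nil =>
    rintro (_ | ⟨c, w⟩) h
    · rfl
    · exact absurd (by simpa using h.symm) (hcons c w)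
  | cons c w ih =>
    rintro (_ | ⟨c', w'⟩) h
    · exact absurd (by simpa using h) (hcons c w)
    · simp only [List.map_cons, List.prod_cons] at h
      have heq : edgeTranslate (t c) (edgeTranslate (w.map t).prod e) =
          edgeTranslate (t c') (edgeTranslate (w'.map t).prod e) := by
        rw [← edgeTranslate_mul, h, edgeTranslate_mul]
      cases c <;> cases c'
      · rw [ih (mul_left_cancel h)]
      · exact absurd heq.symm (htf _ (hmem _) _ (hmem _))
      · exact absurd heq (htf _ (hmem _) _ (hmem _))
      · rw [ih (mul_left_cancel h)]

/-- A binary tree of disjoint translates of a finite set of edges `B` forces `p_c < 1`. -/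
theorem pc_lt_one_of_tree {f : ι → G} {μ : ℝ → Measure (Config (G × ι))}
    (hμ : ∀ p ∈ Set.Icc (0 : ℝ) 1, IsBernoulli p (μ p)) (hne : B.Nonempty)
    (hB : ∀ e ∈ B, e ∈ T) (hT : ∀ c, ∀ e ∈ T, edgeTranslate (t c) e ∈ T)
    (hBT : ∀ c, ∀ e ∈ T, edgeTranslate (t c) e ∉ B)
    (htf : ∀ e ∈ T, ∀ e' ∈ T, edgeTranslate (t true) e ≠ edgeTranslate (t false) e')
    (hconn : ∀ c, ∀ ω : Config (G × ι), (∀ e ∈ B, ω e = true) → Conn f ω 1 (t c)) :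
    pc f μ < 1 := by
  set k := B.card with hk
  have hk1 : (1 : ℝ) ≤ k := by exact_mod_cast hne.card_pos
  set x : ℝ := 1 / (3 * k) with hx
  have hx0 : 0 < x := by positivity
  have hkx : k * x = 1 / 3 := by rw [hx]; field_simp
  have hx1 : x ≤ 1 / 3 := by nlinarith
  have hp : 1 - x ∈ Set.Icc (0 : ℝ) 1 := ⟨by linarith, by linarith⟩
  have hpB : 2 / 3 ≤ (1 - x) ^ k := by
    have := one_add_mul_le_pow (a := -x) (by linarith) k
    rw [← sub_eq_add_neg] at this
    linarith
  have hber := hμ _ hp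
  have := hber.isProbabilityMeasure
  have hinf : (⋂ n, treeEvent t B n 1) ⊆ {ω | (cluster f ω).Infinite} := by
    intro ω hω
    have hw : ∀ n, ∃ w : List Bool, w.length = n ∧ (w.map t).prod ∈ cluster f ω := fun n => by
      obtain ⟨w, hw, h⟩ := exists_conn_of_mem_treeEvent hconn (Set.mem_iInter.mp hω n)
      exact ⟨w, hw, by rwa [one_mul] at h⟩
    choose w hlen hmem using hw
    have hinj : Function.Injective fun n => ((w n).map t).prod := by
      refine (injective_prod_map hne hB hT hBT htf).comp fun m n hmn => ?_
      rw [← hlen m, hmn, hlen n]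
    exact Set.infinite_of_injective_forall_mem hinj hmem
  have hlim := tendsto_measure_iInter_atTop (μ := μ (1 - x)) (s := fun n => treeEvent t B n 1)
    (fun n => (measurableSet_of_dependsOn (dependsOn_treeEvent t B n 1)).nullMeasurableSet)
    (antitone_nat_of_succ_le fun n => treeEvent_succ_subset t B n 1) ⟨0, measure_ne_top _ _⟩
  have hlim' := (ENNReal.tendsto_toReal (measure_ne_top _ _)).comp hlim
  have hhalf : 1 / 2 ≤ (μ (1 - x)).real (⋂ n, treeEvent t B n 1) :=
    ge_of_tendsto' hlim' fun n => hber.half_le_real_treeEvent hp hpB hB hT hBT htf n 1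
  have htheta : 0 < theta f (μ (1 - x)) :=
    lt_of_lt_of_le (by norm_num) (hhalf.trans (measureReal_mono hinf))
  refine lt_of_le_of_lt (csInf_le ⟨0, ?_⟩ (Or.inl ⟨hp, htheta⟩)) (by linarith)
  rintro q (hq | rfl)
  · exact hq.1.1
  · exact zero_le_one

end Tree

end Perc

namespace Perc

section PingPong

/-- `P₁` and `P₂` are ping-pong sets for the images of two groups in `G`; in a free product
these are the elements whose normal form begins with a syllable of the given factor. -/
structure IsPingPong {G H₁ H₂ : Type*} [Group G] [Group H₁] [Group H₂]
    (φ₁ : H₁ →* G) (φ₂ : H₂ →* G) (P₁ P₂ : Set G) : Prop where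
  disjoint : Disjoint P₁ P₂
  one_notMem_left : 1 ∉ P₁
  one_notMem_right : 1 ∉ P₂
  left_mul_mem : ∀ x ≠ 1, ∀ g ∉ P₁, φ₁ x * g ∈ P₁
  right_mul_mem : ∀ y ≠ 1, ∀ g ∉ P₂, φ₂ y * g ∈ P₂

theorem IsPingPong.symm {G H₁ H₂ : Type*} [Group G] [Group H₁] [Group H₂]
    {φ₁ : H₁ →* G} {φ₂ : H₂ →* G} {P₁ P₂ : Set G} (h : IsPingPong φ₁ φ₂ P₁ P₂) :
    IsPingPong φ₂ φ₁ P₂ P₁ :=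
  ⟨h.disjoint.symm, h.one_notMem_right, h.one_notMem_left, h.right_mul_mem, h.left_mul_mem⟩

/-- The two factors as a family indexed by `Bool`, lifted to a common universe. -/
abbrev FactorFamily.{u, v} (G₁ : Type u) (G₂ : Type v) : Bool → Type (max u v)
  | true => ULift.{v} G₁
  | false => ULift.{u} G₂

instance {G₁ G₂ : Type*} [Group G₁] [Group G₂] : ∀ b, Group (FactorFamily G₁ G₂ b)
  | true => inferInstanceAs (Group (ULift G₁))
  | false => inferInstanceAs (Group (ULift G₂))

theorem exists_isPingPong_coprod (G₁ G₂ : Type*) [Group G₁] [Group G₂] :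
    ∃ P₁ P₂, IsPingPong (Monoid.Coprod.inl : G₁ →* Monoid.Coprod G₁ G₂)
      (Monoid.Coprod.inr : G₂ →* Monoid.Coprod G₁ G₂) P₁ P₂ := by
  classical
  let M := FactorFamily G₁ G₂
  let ψ₁ : G₁ →* Monoid.CoprodI M :=
    (Monoid.CoprodI.of (M := M) (i := true)).comp
      (MulEquiv.ulift.symm : G₁ ≃* ULift G₁).toMonoidHom
  let ψ₂ : G₂ →* Monoid.CoprodI M :=
    (Monoid.CoprodI.of (M := M) (i := false)).comp
      (MulEquiv.ulift.symm : G₂ ≃* ULift G₂).toMonoidHom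
  let φ := Monoid.Coprod.lift ψ₁ ψ₂
  let P : Bool → Set (Monoid.Coprod G₁ G₂) := fun b =>
    {g | (φ g • (Monoid.CoprodI.Word.empty : Monoid.CoprodI.Word M)).fstIdx = some b}
  have hmul : ∀ (b : Bool) (m : M b) (x g : Monoid.Coprod G₁ G₂),
      φ x = Monoid.CoprodI.of m → m ≠ 1 → g ∉ P b → x * g ∈ P b := by
    intro b m x g hx hm hg
    change Monoid.CoprodI.Word.fstIdx (φ (x * g) • _) = some b
    rw [map_mul, mul_smul, hx, ← Monoid.CoprodI.Word.cons_eq_smul (h1 := hg) (h2 := hm),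
      Monoid.CoprodI.Word.fstIdx_cons]
  have hone : ∀ b, 1 ∉ P b := by
    intro b hb
    change Monoid.CoprodI.Word.fstIdx (φ 1 • _) = some b at hb
    simp [Monoid.CoprodI.Word.fstIdx, Monoid.CoprodI.Word.empty] at hb
  refine ⟨P true, P false, ?_, hone true, hone false, fun x hx g hg => ?_, fun y hy g hg => ?_⟩
  · refine Set.disjoint_left.mpr fun g h₁ h₂ => ?_
    exact absurd (h₁.symm.trans h₂) (by simp)
  · exact hmul true (ULift.up x) _ g (Monoid.Coprod.lift_apply_inl ..)
      (fun h => hx (congrArg ULift.down h)) hg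
  · exact hmul false (ULift.up y) _ g (Monoid.Coprod.lift_apply_inr ..)
      (fun h => hy (congrArg ULift.down h)) hg

theorem IsPingPong.pc_lt_one {G H₁ H₂ ι : Type*} [Group G] [Group H₁] [Group H₂] [Nontrivial H₂]
    {φ₁ : H₁ →* G} {φ₂ : H₂ →* G} {P₁ P₂ : Set G} (h : IsPingPong φ₁ φ₂ P₁ P₂)
    {S₁ : Set H₁} {S₂ : Set H₂} (hgen₁ : Subgroup.closure S₁ = ⊤)
    (hgen₂ : Subgroup.closure S₂ = ⊤) {f : ι → G} (j₁ : S₁ → ι) (j₂ : S₂ → ι)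
    (hj₁ : ∀ s, f (j₁ s) = φ₁ s) (hj₂ : ∀ s, f (j₂ s) = φ₂ s) (hj : ∀ s s', j₁ s ≠ j₂ s')
    {μ : ℝ → Measure (Config (G × ι))} (hμ : ∀ p ∈ Set.Icc (0 : ℝ) 1, IsBernoulli p (μ p))
    {a : Bool → H₁} (ha : ∀ c, a c ≠ 1) (haa : a true ≠ a false) : pc f μ < 1 := by
  classical
  obtain ⟨b, hb⟩ := exists_ne (1 : H₂)
  choose A hA hAconn using fun c =>
    exists_finset_conn (f := f) φ₁ j₁ hj₁ (hgen₁.symm ▸ Subgroup.mem_top (a c))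
  obtain ⟨A', hA', hA'conn⟩ :=
    exists_finset_conn (f := f) φ₂ j₂ hj₂ (hgen₂.symm ▸ Subgroup.mem_top b)
  obtain ⟨s, hs⟩ : S₁.Nonempty := by
    rw [Set.nonempty_iff_ne_empty]
    rintro rfl
    have : a true ∈ (⊤ : Subgroup H₁) := Subgroup.mem_top _
    rw [← hgen₁, Subgroup.closure_empty, Subgroup.mem_bot] at this
    exact ha true this
  have hleft : ∀ x, φ₁ x ∉ P₂ := fun x => by
    by_cases hx : x = 1
    · rw [hx, map_one]
      exact h.one_notMem_right
    · have := h.left_mul_mem x hx 1 h.one_notMem_left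
      rw [mul_one] at this
      exact Set.disjoint_left.mp h.disjoint this
  have hright : ∀ y, φ₂ y ∉ P₁ := fun y => by
    by_cases hy : y = 1
    · rw [hy, map_one]
      exact h.one_notMem_left
    · have := h.right_mul_mem y hy 1 h.one_notMem_right
      rw [mul_one] at this
      exact Set.disjoint_right.mp h.disjoint this
  let t : Bool → G := fun c => φ₁ (a c) * φ₂ b
  let B : Finset (G × ι) := insert (1, j₁ ⟨s, hs⟩) (Finset.univ.biUnion fun c =>
    A c ∪ A'.image (edgeTranslate (φ₁ (a c))))
  have hBcases : ∀ e ∈ B, ((∃ x, φ₁ x = e.1) ∧ e.2 ∈ Set.range j₁) ∨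
      ((∃ c y, φ₁ (a c) * φ₂ y = e.1) ∧ e.2 ∈ Set.range j₂) := by
    intro e he
    simp only [B, Finset.mem_insert, Finset.mem_biUnion, Finset.mem_union, Finset.mem_univ,
      true_and, Finset.mem_image] at he
    obtain rfl | ⟨c, he | ⟨e', he', rfl⟩⟩ := he
    · exact .inl ⟨⟨1, map_one φ₁⟩, ⟨_, rfl⟩⟩
    · exact .inl (hA c e he)
    · obtain ⟨⟨y, hy⟩, hj'⟩ := hA' e' he'
      exact .inr ⟨⟨c, y, by simp [edgeTranslate, hy]⟩, hj'⟩
  let T : Set (G × ι) := {e | (e.1 ∉ P₂ ∧ e.2 ∈ Set.range j₁) ∨ (e.1 ∈ P₁ ∧ e.2 ∈ Set.range j₂)}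
  have hTP : ∀ e ∈ T, e.1 ∉ P₂ := by
    rintro e (he | he)
    · exact he.1
    · exact Set.disjoint_left.mp h.disjoint he.1
  have hbmem : ∀ e ∈ T, φ₂ b * e.1 ∈ P₂ := fun e he => h.right_mul_mem b hb _ (hTP e he)
  have hbnot : ∀ e ∈ T, φ₂ b * e.1 ∉ P₁ := fun e he =>
    Set.disjoint_right.mp h.disjoint (hbmem e he)
  have habmem : ∀ c, ∀ e ∈ T, t c * e.1 ∈ P₁ := fun c e he => by
    rw [mul_assoc]
    exact h.left_mul_mem _ (ha c) _ (hbnot e he)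
  have hne : ∀ c c', c ≠ c' → (a c')⁻¹ * a c ≠ 1 := by
    intro c c' hcc' heq
    rw [inv_mul_eq_one] at heq
    cases c <;> cases c'
    · exact hcc' rfl
    · exact haa heq
    · exact haa heq.symm
    · exact hcc' rfl
  have hcross : ∀ c c', c ≠ c' → ∀ e ∈ T, φ₁ (a c')⁻¹ * (t c * e.1) ∈ P₁ := by
    intro c c' hcc' e he
    have := h.left_mul_mem _ (hne c c' hcc') _ (hbnot e he)
    simpa [t, mul_assoc] using this
  refine pc_lt_one_of_tree (t := t) (B := B) (T := T) hμ ⟨_, Finset.mem_insert_self _ _⟩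
    ?_ ?_ ?_ ?_ ?_
  · intro e he
    obtain ⟨⟨x, hx⟩, hj'⟩ | ⟨⟨c, y, hy⟩, hj'⟩ := hBcases e he
    · exact .inl ⟨hx ▸ hleft x, hj'⟩
    · exact .inr ⟨hy ▸ h.left_mul_mem _ (ha c) _ (hright y), hj'⟩
  · rintro c e he
    have hmem := habmem c e he
    exact he.imp (fun he => ⟨Set.disjoint_left.mp h.disjoint hmem, he.2⟩) fun he => ⟨hmem, he.2⟩
  · intro c e he heB
    obtain ⟨⟨x, hx⟩, -⟩ | ⟨⟨c', y, hy⟩, ⟨s', hs'⟩⟩ := hBcases _ heB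
    · refine hleft ((a c)⁻¹ * x) ?_
      rw [map_mul, hx]
      simpa [t, edgeTranslate, mul_assoc] using hbmem e he
    · by_cases hcc' : c = c'
      · subst hcc'
        obtain ⟨-, s'', hs''⟩ | ⟨he₁, -⟩ := he
        · exact hj _ _ (hs''.trans hs'.symm)
        · refine hright (b⁻¹ * y) ?_
          have : φ₂ y = φ₂ b * e.1 := by
            simpa [t, edgeTranslate, mul_assoc] using hy
          rwa [map_mul, this, map_inv, inv_mul_cancel_left]
      · refine hright y ?_
        have := hcross c c' hcc' e he
        have hy' : φ₁ (a c') * φ₂ y = t c * e.1 := hy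
        rwa [← hy', map_inv, inv_mul_cancel_left] at this
  · intro e he e' he' heq
    have heq' : t true * e.1 = t false * e'.1 := congrArg Prod.fst heq
    have h₁ := hcross true false (by simp) e he
    rw [heq', map_inv] at h₁
    refine hbnot e' he' ?_
    simpa [t, mul_assoc] using h₁
  · intro c ω hω
    have hmem : ∀ e ∈ A c ∪ A'.image (edgeTranslate (φ₁ (a c))), ω e = true := fun e he =>
      hω e (Finset.mem_insert_of_mem (Finset.mem_biUnion.mpr ⟨c, Finset.mem_univ c, he⟩))
    have h₁ := hAconn c ω fun e he => hmem e (Finset.mem_union_left _ he)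
    have h₂ := (hA'conn (fun e => ω (edgeTranslate (φ₁ (a c)) e)) fun e he =>
      hmem _ (Finset.mem_union_right _ (Finset.mem_image_of_mem _ he))).translate
    rw [mul_one] at h₂
    exact h₁.trans h₂

end PingPong

end Perc

namespace Perc

section Line

variable {G ι : Type*} [Group G] (l : Bool → G)

/-- The vertices of the line in the Cayley graph obtained by alternately multiplying by
`l true` and `l false`. -/
def lineVertex (n : ℤ) : G :=
  (l true * l false) ^ (n / 2) * if Even n then 1 else l true

/-- The letter used to pass from the `n`-th to the `(n + 1)`-st vertex of the line. -/
def lineLetter (n : ℤ) : Bool := decide (Even n)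

theorem lineLetter_add_one (n : ℤ) : lineLetter (n + 1) = !lineLetter n := by
  rw [lineLetter, lineLetter, ← decide_not]
  exact decide_eq_decide.mpr Int.even_add_one

theorem lineVertex_zero : lineVertex l 0 = 1 := by simp [lineVertex]

theorem lineVertex_add_one (n : ℤ) :
    lineVertex l (n + 1) = lineVertex l n * l (lineLetter n) := by
  obtain ⟨k, rfl⟩ | ⟨k, rfl⟩ := n.even_or_odd
  · have h₁ : (k + k + 1) / 2 = k := by omega
    have h₂ : (k + k) / 2 = k := by omega
    simp [lineVertex, lineLetter, h₁, h₂]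
  · have h₁ : (2 * k + 1 + 1) / 2 = k + 1 := by omega
    have h₂ : (2 * k + 1) / 2 = k := by omega
    have h₃ : ¬Even (2 * k + 1) := Int.not_even_two_mul_add_one k
    have h₄ : Even (2 * k + 1 + 1) := Int.even_add_one.mpr h₃
    simp only [lineVertex, lineLetter, h₁, h₂, h₃, h₄, if_true, if_false, decide_false,
      zpow_add_one, mul_one, mul_assoc]

variable {l} {P : Bool → Set G}

theorem lineVertex_injective (hP : Disjoint (P true) (P false)) (hone : ∀ c, 1 ∉ P c)
    (hmul : ∀ c, ∀ g ∉ P c, l c * g ∈ P c) : Function.Injective (lineVertex l) := by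
  have hdisj : ∀ c, ∀ g ∈ P (!c), g ∉ P c := by
    intro c g hg hg'
    cases c
    · exact Set.disjoint_left.mp hP hg hg'
    · exact Set.disjoint_left.mp hP hg' hg
  have key : ∀ (k : ℕ) (n : ℤ),
      (lineVertex l n)⁻¹ * lineVertex l (n + (k + 1 : ℕ)) ∈ P (lineLetter n) := by
    intro k
    induction k with
    | zero =>
      intro n
      have := hmul (lineLetter n) 1 (hone _)
      simpa [lineVertex_add_one] using this
    | succ k ih =>
      intro n
      have h₁ := ih (n + 1)
      rw [lineLetter_add_one] at h₁
      have h₂ := hmul _ _ (hdisj _ _ h₁)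
      rw [lineVertex_add_one, mul_inv_rev, mul_assoc, mul_inv_cancel_left] at h₂
      convert h₂ using 3
      push_cast
      ring
  intro m n hmn
  by_contra hne
  wlog hlt : m < n generalizing m n
  · exact this hmn.symm (Ne.symm hne) (lt_of_le_of_ne (not_lt.mp hlt) (Ne.symm hne))
  obtain ⟨k, hk⟩ := Int.eq_ofNat_of_zero_le (show 0 ≤ n - m - 1 by omega)
  have := key k m
  rw [show m + ((k + 1 : ℕ) : ℤ) = n by push_cast; omega, hmn, inv_mul_cancel] at this
  exact hone _ this

variable {f : ι → G} {j : Bool → ι}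

open scoped Classical in
/-- The two parallel edges joining the `n`-th and the `(n + 1)`-st vertex of the line. -/
noncomputable def lineEdges (l : Bool → G) (j : Bool → ι) (n : ℤ) : Finset (G × ι) :=
  {(lineVertex l n, j (lineLetter n)), (lineVertex l (n + 1), j (lineLetter n))}

theorem cluster_finite_of_lineEdges_closed (hl : ∀ c, l c * l c = 1) (hf : ∀ c, f (j c) = l c)
    (hι : ∀ i, f i = 1 ∨ ∃ c, i = j c) {ω : Config (G × ι)} {m n : ℤ} (hm : m < 0) (hn : 0 ≤ n)
    (hmω : ∀ e ∈ lineEdges l j m, ω e ≠ true) (hnω : ∀ e ∈ lineEdges l j n, ω e ≠ true) :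
    (cluster f ω).Finite := by
  refine ((Set.finite_Icc (m + 1) n).image (lineVertex l)).subset fun x hx => ?_
  change Conn f ω 1 x at hx
  induction hx with
  | refl => exact ⟨0, ⟨by omega, hn⟩, lineVertex_zero l⟩
  | @tail x y _ hxy ih =>
    obtain ⟨k, ⟨hmk, hkn⟩, rfl⟩ := ih
    obtain ⟨i, hi⟩ := hxy
    obtain h1 | ⟨c, rfl⟩ := hι i
    · have hy : y = lineVertex l k := by
        rw [h1] at hi
        obtain ⟨-, h⟩ | ⟨-, h⟩ := hi
        · simpa using h
        · simpa using h.symm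
      exact ⟨k, ⟨hmk, hkn⟩, hy.symm⟩
    · have hy : y = lineVertex l k * l c := by
        rw [hf] at hi
        obtain ⟨-, h⟩ | ⟨-, h⟩ := hi
        · exact h
        · rw [h, mul_assoc, hl, mul_one]
      have hopen : ω (lineVertex l k, j c) = true ∨ ω (y, j c) = true := hi.imp And.left And.left
      by_cases hc : c = lineLetter k
      · subst hc
        rw [← lineVertex_add_one] at hy
        subst hy
        refine ⟨k + 1, ⟨by omega, ?_⟩, rfl⟩
        rcases hkn.lt_or_eq with hlt | rfl
        · omega
        · exfalso
          obtain h | h := hopen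
          · exact hnω _ (by simp [lineEdges]) h
          · exact hnω _ (by simp [lineEdges]) h
      · have hk := lineLetter_add_one (k - 1)
        rw [sub_add_cancel] at hk
        have hc' : c = lineLetter (k - 1) := by
          rw [hk] at hc
          cases c <;> cases h : lineLetter (k - 1) <;> simp_all
        subst hc'
        have hv := lineVertex_add_one l (k - 1)
        rw [sub_add_cancel] at hv
        have hy' : y = lineVertex l (k - 1) := by rw [hy, hv, mul_assoc, hl, mul_one]
        subst hy'
        refine ⟨k - 1, ⟨?_, by omega⟩, rfl⟩
        by_contra hlt
        obtain rfl : m = k - 1 := by omega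
        obtain h | h := hopen
        · exact hmω _ (by simp [lineEdges]) h
        · exact hmω _ (by simp [lineEdges]) h

theorem disjoint_lineEdges (hinj : Function.Injective (lineVertex l))
    (hj : Function.Injective j) : Pairwise (Function.onFun Disjoint (lineEdges l j)) := by
  intro m n hmn
  refine Finset.disjoint_left.mpr fun e hem hen => hmn ?_
  have hcase : ∀ k, e ∈ lineEdges l j k →
      e.2 = j (lineLetter k) ∧ (e.1 = lineVertex l k ∨ e.1 = lineVertex l (k + 1)) := by
    intro k hk
    simp only [lineEdges, Finset.mem_insert, Finset.mem_singleton] at hk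
    rcases hk with rfl | rfl <;> simp
  obtain ⟨hm₂, hm₁⟩ := hcase m hem
  obtain ⟨hn₂, hn₁⟩ := hcase n hen
  have hletter : lineLetter m = lineLetter n := hj (hm₂.symm.trans hn₂)
  have hparity : Even m ↔ Even n := by simpa [lineLetter] using hletter
  rw [Int.even_iff, Int.even_iff] at hparity
  obtain hm₁ | hm₁ := hm₁ <;> obtain hn₁ | hn₁ := hn₁ <;>
    (have := hinj (hm₁.symm.trans hn₁); omega)

theorem theta_eq_zero_of_line {p : ℝ} {μ : Measure (Config (G × ι))} (h : IsBernoulli p μ)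
    (hp : p ∈ Set.Icc (0 : ℝ) 1) (hp1 : p < 1) (hP : Disjoint (P true) (P false))
    (hone : ∀ c, 1 ∉ P c) (hmul : ∀ c, ∀ g ∉ P c, l c * g ∈ P c)
    (hl : ∀ c, l c * l c = 1) (hf : ∀ c, f (j c) = l c) (hj : Function.Injective j)
    (hι : ∀ i, f i = 1 ∨ ∃ c, i = j c) : theta f μ = 0 := by
  classical
  have hdisj := disjoint_lineEdges (lineVertex_injective hP hone hmul) hj
  have hzero : ∀ s : ℕ → ℤ, Function.Injective s →
      μ {ω | ∀ n, ∃ e ∈ lineEdges l j (s n), ω e = true} = 0 := fun s hs =>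
    h.measure_forall_exists_open hp hp1 (hdisj.comp_of_injective hs) fun n =>
      Finset.card_le_two
  have hsub : {ω | (cluster f ω).Infinite} ⊆
      {ω | ∀ n : ℕ, ∃ e ∈ lineEdges l j n, ω e = true} ∪
        {ω | ∀ n : ℕ, ∃ e ∈ lineEdges l j (-n - 1), ω e = true} := by
    intro ω hω
    by_contra hnot
    simp only [Set.mem_union, Set.mem_ofPred_eq, not_or, not_forall, not_exists, not_and] at hnot
    obtain ⟨⟨n, hn⟩, m, hm⟩ := hnot
    exact hω (cluster_finite_of_lineEdges_closed hl hf hι (by omega) (by omega) hm hn)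
  have hnull := measure_mono_null hsub (measure_union_null
    (hzero (fun n => n) fun m n hmn => by simpa using hmn)
    (hzero (fun n => -n - 1) fun m n hmn => by simpa using hmn))
  rw [theta, hnull, ENNReal.toReal_zero]

end Line

theorem exists_of_card_ne_two {H : Type*} [Group H] [Nontrivial H] (h : Nat.card H ≠ 2) :
    ∃ a : Bool → H, (∀ c, a c ≠ 1) ∧ a true ≠ a false := by
  obtain ⟨x, hx⟩ := exists_ne (1 : H)
  obtain ⟨y, hy1, hyx⟩ : ∃ y : H, y ≠ 1 ∧ y ≠ x := by
    by_contra! hall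
    refine h (Nat.card_eq_two_iff.mpr ⟨1, x, hx.symm, Set.eq_univ_of_forall fun y => ?_⟩)
    by_cases hy : y = 1
    · exact .inl hy
    · exact .inr (hall y hy)
  exact ⟨fun c => if c then x else y, fun c => by cases c <;> simpa, by simpa using hyx.symm⟩

/-- In a group of order two, every generating set contains the nontrivial element, which is
an involution. -/
theorem exists_mem_of_card_eq_two {H : Type*} [Group H] [Nontrivial H] (h : Nat.card H = 2)
    {S : Set H} (hS : Subgroup.closure S = ⊤) :
    ∃ a ∈ S, a ≠ 1 ∧ a * a = 1 ∧ ∀ x, x ≠ 1 → x = a := by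
  obtain ⟨a, haS, ha⟩ : ∃ a ∈ S, a ≠ 1 := by
    by_contra! hall
    have hbot : Subgroup.closure S = ⊥ := Subgroup.closure_eq_bot_iff.mpr hall
    exact bot_ne_top (hbot.symm.trans hS)
  have huniq : ∀ x, x ≠ 1 → x = a := by
    obtain ⟨u, v, huv, huniv⟩ := Nat.card_eq_two_iff.mp h
    have hmem : ∀ x : H, x = u ∨ x = v := fun x => by
      have : x ∈ ({u, v} : Set H) := huniv ▸ Set.mem_univ x
      simpa using this
    intro x hx
    rcases hmem x with rfl | rfl <;> rcases hmem a with rfl | rfl <;>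
      rcases hmem 1 with h1 | h1 <;> simp_all
  refine ⟨a, haS, ha, ?_, huniq⟩
  by_contra haa
  exact ha (mul_eq_left.mp (huniq _ haa))

theorem pc_eq_one_of_theta {G ι : Type*} [Group G] {f : ι → G}
    {μ : ℝ → Measure (Config (G × ι))}
    (h : ∀ p ∈ Set.Icc (0 : ℝ) 1, p < 1 → theta f (μ p) = 0) : pc f μ = 1 := by
  have hset : {p | p ∈ Set.Icc (0 : ℝ) 1 ∧ 0 < theta f (μ p)} ∪ {1} = {1} := by
    refine Set.union_eq_self_of_subset_left ?_
    rintro p ⟨hp, hθ⟩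
    by_contra hp1
    exact hθ.ne' (h p hp (lt_of_le_of_ne hp.2 hp1))
  rw [pc, hset, csInf_singleton]

end Perc

open Perc

/-- For nontrivial finitely generated groups `G₁, G₂` with finite
generating sets `S₁, S₂`, the critical probability of the Cayley graph of `G₁ * G₂`
w.r.t. `S₁ ⊔ S₂` equals `1` iff both `G₁` and `G₂` have exactly two elements. -/
theorem pc_free_product_eq_one_iff
    {G₁ G₂ : Type*} [Group G₁] [Group G₂] [Nontrivial G₁] [Nontrivial G₂]
    (S₁ : Set G₁) (S₂ : Set G₂) (hfin₁ : S₁.Finite) (hfin₂ : S₂.Finite)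
    (hgen₁ : Subgroup.closure S₁ = ⊤) (hgen₂ : Subgroup.closure S₂ = ⊤)
    (μ : ℝ → Measure (Config (Monoid.Coprod G₁ G₂ × (S₁ ⊕ S₂))))
    (hμ : ∀ p ∈ Set.Icc (0 : ℝ) 1, IsBernoulli p (μ p)) :
    pc (coprodGens S₁ S₂) μ = 1 ↔ Nat.card G₁ = 2 ∧ Nat.card G₂ = 2 := by
  obtain ⟨P₁, P₂, hP⟩ := exists_isPingPong_coprod G₁ G₂
  constructor
  · intro hpc
    by_contra hcard
    refine hpc.not_lt ?_
    rcases not_and_or.mp hcard with h | h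
    · obtain ⟨a, ha, haa⟩ := exists_of_card_ne_two h
      exact hP.pc_lt_one hgen₁ hgen₂ Sum.inl Sum.inr (fun _ => rfl) (fun _ => rfl)
        (fun _ _ => Sum.inl_ne_inr) hμ ha haa
    · obtain ⟨a, ha, haa⟩ := exists_of_card_ne_two h
      exact hP.symm.pc_lt_one hgen₂ hgen₁ Sum.inr Sum.inl (fun _ => rfl) (fun _ => rfl)
        (fun _ _ => Sum.inr_ne_inl) hμ ha haa
  · rintro ⟨h₁, h₂⟩
    obtain ⟨a, haS, ha, haa, hauniq⟩ := exists_mem_of_card_eq_two h₁ hgen₁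
    obtain ⟨b, hbS, hb, hbb, hbuniq⟩ := exists_mem_of_card_eq_two h₂ hgen₂
    refine pc_eq_one_of_theta fun p hp hp1 => theta_eq_zero_of_line (hμ p hp) hp hp1
      (P := fun c => if c then P₁ else P₂)
      (l := fun c => if c then Monoid.Coprod.inl a else Monoid.Coprod.inr b)
      (j := fun c => if c then Sum.inl ⟨a, haS⟩ else Sum.inr ⟨b, hbS⟩)
      (by simpa using hP.disjoint) ?_ ?_ ?_ ?_ ?_ ?_
    · rintro (_ | _)
      · exact hP.one_notMem_right
      · exact hP.one_notMem_left
    · rintro (_ | _)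
      · exact hP.right_mul_mem b hb
      · exact hP.left_mul_mem a ha
    · rintro (_ | _)
      · simp [← map_mul, hbb]
      · simp [← map_mul, haa]
    · rintro (_ | _) <;> rfl
    · rintro (_ | _) (_ | _) <;> simp
    · rintro (⟨x, hx⟩ | ⟨y, hy⟩)
      · by_cases hx1 : x = 1
        · exact .inl (by simp [coprodGens, hx1])
        · exact .inr ⟨true, by simp [hauniq x hx1]⟩
      · by_cases hy1 : y = 1
        · exact .inl (by simp [coprodGens, hy1])
        · exact .inr ⟨false, by simp [hbuniq y hy1]⟩
end
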